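/- arXiv:1304.0761 — 2 statements merged into one kernel-verified Lean document; each statement's English description precedes it below -/
import Mathlib

section
/- The class CA↑ of directed cylindric algebras has the superamalgamation property: for all A, B, C ∈ CA↑ and monomorphisms f : C → A and g : C → B there exist D ∈ CA↑ and monomorphisms m : A → D and n : B → D with m∘f = n∘g, and such that for all a ∈ A and b ∈ B with m(a) ≤ n(b) there exists t ∈ C with a ≤ f(t) and g(t) ≤ b. -/
/-- The similarity type of directed cylindric algebras of dimension `n`:
meet, complement, upward and downward directed cylindrifications, and diagonals. -/
structure DSig (n : ℕ) (A : Type) where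
  inf : A → A → A
  compl : A → A
  cylu : Fin n → A → A
  cyld : Fin n → A → A
  diag : Fin n → Fin n → A

/-- A bundled algebra of the directed cylindric similarity type of dimension `n`. -/
structure DAlg (n : ℕ) where
  carrier : Type
  str : DSig n carrier

/-- `⟨U; R⟩` is a P-structure: any two elements have a "pair". -/
def IsPStruct (U : Type) (R : U → U → Prop) : Prop :=
  ∀ a b : U, ∃ c : U, ∀ d : U, R d c ↔ d = a ∨ d = b

/-- `⟨U; R⟩` is a weak P-structure. -/
def IsWeakPStruct (U : Type) (R : U → U → Prop) : Prop :=
  ∀ a b : U, ∃ c : U, R a c ∧ R b c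

/-- `⟨U; R⟩` is extensional: points with the same `R`-children coincide. -/
def IsExtensional (U : Type) (R : U → U → Prop) : Prop :=
  ∀ a b : U, (∀ z : U, R z a ↔ R z b) → a = b

/-- The full w-directed cylindric set algebra of dimension `n` with base `⟨U; R⟩`. -/
def fullDAlg (n : ℕ) (U : Type) (R : U → U → Prop) : DAlg n where
  carrier := Set (Fin n → U)
  str :=
    { inf := fun X Y => X ∩ Y
      compl := fun X => Xᶜ
      cylu := fun i X =>
        {s | ∃ z ∈ X, R (z i) (s i) ∧ ∀ j : Fin n, j ≠ i → s j = z j}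
      cyld := fun i X =>
        {s | ∃ z ∈ X, R (s i) (z i) ∧ ∀ j : Fin n, j ≠ i → s j = z j}
      diag := fun i j => {s | s i = s j} }

/-- A homomorphism of algebras of the directed cylindric similarity type. -/
def DHom {n : ℕ} (A B : DAlg n) (f : A.carrier → B.carrier) : Prop :=
  (∀ x y, f (A.str.inf x y) = B.str.inf (f x) (f y)) ∧
  (∀ x, f (A.str.compl x) = B.str.compl (f x)) ∧
  (∀ (i : Fin n) x, f (A.str.cylu i x) = B.str.cylu i (f x)) ∧
  (∀ (i : Fin n) x, f (A.str.cyld i x) = B.str.cyld i (f x)) ∧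
  (∀ i j : Fin n, f (A.str.diag i j) = B.str.diag i j)

/-- The product of a family of algebras of the directed cylindric similarity type. -/
def prodDAlg {n : ℕ} {ι : Type} (B : ι → DAlg n) : DAlg n where
  carrier := ∀ i : ι, (B i).carrier
  str :=
    { inf := fun x y i => (B i).str.inf (x i) (y i)
      compl := fun x i => (B i).str.compl (x i)
      cylu := fun k x i => (B i).str.cylu k (x i)
      cyld := fun k x i => (B i).str.cyld k (x i)
      diag := fun k l i => (B i).str.diag k l }

/-- `Cs↑_n`: subalgebras of full w-directed cylindric set algebras whose base is an
extensional P-structure. -/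
def CsUp (n : ℕ) : Set (DAlg n) :=
  {A | ∃ (U : Type) (R : U → U → Prop), IsPStruct U R ∧ IsExtensional U R ∧
        ∃ f : A.carrier → (fullDAlg n U R).carrier,
          Function.Injective f ∧ DHom A (fullDAlg n U R) f}

/-- `RCA↑_n = SP Cs↑_n`: the representable directed cylindric algebras of dimension `n`,
i.e. algebras embeddable into a product of members of `Cs↑_n`. -/
def RCAup (n : ℕ) : Set (DAlg n) :=
  {A | ∃ (ι : Type) (B : ι → DAlg n), (∀ i, B i ∈ CsUp n) ∧
        ∃ f : A.carrier → (prodDAlg B).carrier, Function.Injective f ∧ DHom A (prodDAlg B) f}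

/-- The Boolean partial order of an algebra of the directed cylindric similarity type:
`x ≤ y` iff `x ⊓ y = x`. -/
def dLe {n : ℕ} (A : DAlg n) (x y : A.carrier) : Prop := A.str.inf x y = x

namespace DCA

open Function

structure Mod {n : ℕ} (A : DAlg n) where
  U : Type
  R : U → U → Prop
  h : A.carrier → (Fin n → U) → Prop
  pst : IsPStruct U R
  ext : IsExtensional U R
  h_inf : ∀ x y s, h (A.str.inf x y) s ↔ h x s ∧ h y s
  h_compl : ∀ x s, h (A.str.compl x) s ↔ ¬ h x s
  h_cylu : ∀ i x s, h (A.str.cylu i x) s ↔ ∃ u, R u (s i) ∧ h x (update s i u)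
  h_cyld : ∀ i x s, h (A.str.cyld i x) s ↔ ∃ u, R (s i) u ∧ h x (update s i u)
  h_diag : ∀ i j s, h (A.str.diag i j) s ↔ s i = s j

variable {n : ℕ} {A B C : DAlg n}

def Mod.red (M : Mod A) {f : C.carrier → A.carrier} (hf : DHom C A f) : Mod C where
  U := M.U
  R := M.R
  h := fun x s => M.h (f x) s
  pst := M.pst
  ext := M.ext
  h_inf := fun x y s => by rw [hf.1, M.h_inf]
  h_compl := fun x s => by rw [hf.2.1, M.h_compl]
  h_cylu := fun i x s => by rw [hf.2.2.1, M.h_cylu]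
  h_cyld := fun i x s => by rw [hf.2.2.2.1, M.h_cyld]
  h_diag := fun i j s => by rw [hf.2.2.2.2, M.h_diag]

abbrev Pred (A : DAlg n) := ∀ M : Mod A, (Fin n → M.U) → Prop
abbrev BRel (A : DAlg n) := ∀ M : Mod A, M.U → M.U → Prop
abbrev UPred (A : DAlg n) := ∀ M : Mod A, M.U → Prop

def Rep (P : Pred A) : Prop := ∃ x, ∀ (M : Mod A) s, M.h x s ↔ P M s
def Mov (Q : BRel A) : Prop :=
  ∀ i P, Rep P → Rep (A := A) (fun M s => ∃ u, Q M (s i) u ∧ P M (update s i u))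
def UT (T : UPred A) : Prop := ∀ i, Rep (A := A) (fun M s => T M (s i))
def Func (Q : BRel A) : Prop := ∀ M z u u', Q M z u → Q M z u' → u = u'

theorem Rep.congr {P Q : Pred A} (hP : Rep P) (h : ∀ M s, P M s ↔ Q M s) : Rep Q := by
  obtain ⟨x, hx⟩ := hP
  exact ⟨x, fun M s => (hx M s).trans (h M s)⟩

theorem rep_h (x : A.carrier) : Rep (A := A) (fun M s => M.h x s) := ⟨x, fun _ _ => Iff.rfl⟩

theorem Rep.and {P Q : Pred A} (hP : Rep P) (hQ : Rep Q) :
    Rep (A := A) (fun M s => P M s ∧ Q M s) := by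
  obtain ⟨x, hx⟩ := hP
  obtain ⟨y, hy⟩ := hQ
  exact ⟨A.str.inf x y, fun M s => by rw [M.h_inf, hx, hy]⟩

theorem Rep.not {P : Pred A} (hP : Rep P) : Rep (A := A) (fun M s => ¬ P M s) := by
  obtain ⟨x, hx⟩ := hP
  exact ⟨A.str.compl x, fun M s => by rw [M.h_compl, hx]⟩

theorem Rep.or {P Q : Pred A} (hP : Rep P) (hQ : Rep Q) :
    Rep (A := A) (fun M s => P M s ∨ Q M s) :=
  (hP.not.and hQ.not).not.congr fun M s => by tauto

theorem rep_eq (i j : Fin n) : Rep (A := A) (fun M s => s i = s j) :=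
  ⟨A.str.diag i j, fun M s => M.h_diag i j s⟩

theorem mov_down : Mov (A := A) (fun M z u => M.R u z) := by
  rintro i P ⟨x, hx⟩
  exact ⟨A.str.cylu i x, fun M s => by rw [M.h_cylu]; simp only [hx]⟩

theorem mov_up : Mov (A := A) (fun M z u => M.R z u) := by
  rintro i P ⟨x, hx⟩
  exact ⟨A.str.cyld i x, fun M s => by rw [M.h_cyld]; simp only [hx]⟩

theorem mov_eq : Mov (A := A) (fun M z u => u = z) := by
  intro i P hP
  exact hP.congr fun M s => by simp

theorem Mov.comp {Q Q' : BRel A} (hQ : Mov Q) (hQ' : Mov Q') :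
    Mov (A := A) (fun M z u => ∃ v, Q M z v ∧ Q' M v u) := by
  intro i P hP
  refine (hQ i _ (hQ' i P hP)).congr fun M s => ?_
  simp only [update_self, update_idem]
  constructor
  · rintro ⟨v, h1, u, h2, h3⟩; exact ⟨u, ⟨v, h1, h2⟩, h3⟩
  · rintro ⟨u, ⟨v, h1, h2⟩, h3⟩; exact ⟨v, h1, u, h2, h3⟩

theorem Mov.testr {Q : BRel A} {T : UPred A} (hQ : Mov Q) (hT : UT T) :
    Mov (A := A) (fun M z u => Q M z u ∧ T M u) := by
  intro i P hP
  refine (hQ i _ ((hT i).and hP)).congr fun M s => ?_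
  simp only [update_self, and_assoc]

theorem Mov.testl {Q : BRel A} {T : UPred A} (hQ : Mov Q) (hT : UT T) :
    Mov (A := A) (fun M z u => Q M z u ∧ T M z) := by
  intro i P hP
  refine ((hT i).and (hQ i _ hP)).congr fun M s => ?_
  constructor
  · rintro ⟨h, u, h1, h2⟩; exact ⟨u, ⟨h1, h⟩, h2⟩
  · rintro ⟨u, ⟨h1, h⟩, h2⟩; exact ⟨h, u, h1, h2⟩

theorem Rep.ex {P : Pred A} (hP : Rep P) (i : Fin n) :
    Rep (A := A) (fun M s => ∃ u, P M (update s i u)) := by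
  refine ((mov_up.comp mov_down) i P hP).congr fun M s => ?_
  constructor
  · rintro ⟨u, -, h⟩; exact ⟨u, h⟩
  · rintro ⟨u, h⟩
    obtain ⟨c, hc⟩ := M.pst (s i) u
    exact ⟨u, ⟨c, (hc _).2 (Or.inl rfl), (hc _).2 (Or.inr rfl)⟩, h⟩

theorem Mov.rel {Q : BRel A} (hQ : Mov Q) {i j : Fin n} (hij : i ≠ j) :
    Rep (A := A) (fun M s => Q M (s i) (s j)) := by
  refine (hQ i _ (rep_eq i j)).congr fun M s => ?_
  simp [update_of_ne hij.symm]

theorem exists_two (hn : 3 ≤ n) (i : Fin n) : ∃ j k : Fin n, i ≠ j ∧ i ≠ k ∧ j ≠ k := by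
  obtain ⟨i, hi⟩ := i
  by_cases h0 : i = 0
  · exact ⟨⟨1, by omega⟩, ⟨2, by omega⟩, by simp [h0], by simp [h0], by simp⟩
  by_cases h1 : i = 1
  · exact ⟨⟨0, by omega⟩, ⟨2, by omega⟩, by simp [h1], by simp [h1], by simp⟩
  · exact ⟨⟨0, by omega⟩, ⟨1, by omega⟩, by simpa using h0, by simpa using h1, by simp⟩

def FuncAt (Q : BRel A) : UPred A := fun M z => ∀ u u', Q M z u → Q M z u' → u = u'

theorem ut_func (hn : 3 ≤ n) {Q : BRel A} (hQ : Mov Q) : UT (FuncAt Q) := by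
  intro i
  obtain ⟨j, k, hij, hik, hjk⟩ := exists_two hn i
  refine ((((hQ.rel hij).and (hQ.rel hik)).and (rep_eq j k).not).ex k |>.ex j).not.congr
    fun M s => ?_
  simp only [update_self, update_of_ne hij, update_of_ne hik, update_of_ne hjk, FuncAt]
  push Not
  constructor
  · intro h u u' h1 h2; exact h u u' ⟨h1, h2⟩
  · intro h u u' h1; exact h u u' h1.1 h1.2

def Down (A : DAlg n) : BRel A := fun M z u => M.R u z
def Sing (A : DAlg n) : UPred A := FuncAt (Down A)
def T2 (A : DAlg n) : UPred A := fun M z => ¬ Sing A M z ∨ ∀ y, Sing A M y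
def Q1 (A : DAlg n) : BRel A := fun M z u => ∃ v, (Down A M z v ∧ Sing A M v) ∧ Down A M v u
def Q2 (A : DAlg n) : BRel A := fun M z u => ∃ v, (Down A M z v ∧ T2 A M v) ∧ Q1 A M v u
def Fst (A : DAlg n) : BRel A := fun M z u => Q1 A M z u ∧ FuncAt (Q1 A) M z
def Snd (A : DAlg n) : BRel A := fun M z u => Q2 A M z u ∧ FuncAt (Q2 A) M z

theorem ut_sing (hn : 3 ≤ n) : UT (Sing A) := ut_func hn mov_down
theorem ut_T2 (hn : 3 ≤ n) : UT (T2 A) := by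
  intro i
  refine ((ut_sing hn i).not.or (((ut_sing hn i).not.ex i).not)).congr fun M s => ?_
  simp [T2]
theorem mov_Q1 (hn : 3 ≤ n) : Mov (Q1 A) := (mov_down.testr (ut_sing hn)).comp mov_down
theorem mov_Q2 (hn : 3 ≤ n) : Mov (Q2 A) := (mov_down.testr (ut_T2 hn)).comp (mov_Q1 hn)
theorem mov_Fst (hn : 3 ≤ n) : Mov (Fst A) := (mov_Q1 hn).testl (ut_func hn (mov_Q1 hn))
theorem mov_Snd (hn : 3 ≤ n) : Mov (Snd A) := (mov_Q2 hn).testl (ut_func hn (mov_Q2 hn))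
theorem mov_FstInv (hn : 3 ≤ n) : Mov (A := A) (fun M z u => Fst A M u z) := by
  intro i P hP
  refine ((((mov_up.testr (ut_sing hn)).comp mov_up).testr (ut_func hn (mov_Q1 hn))) i P hP).congr
    fun M s => ?_
  refine exists_congr fun u => and_congr_left fun _ => ?_
  simp only [Fst, Q1, Down]
  refine and_congr_left fun _ => exists_congr fun v => ?_
  tauto
theorem func_Fst : Func (Fst A) := fun _ _ _ _ h1 h2 => h1.2 _ _ h1.1 h2.1
theorem func_Snd : Func (Snd A) := fun _ _ _ _ h1 h2 => h1.2 _ _ h1.1 h2.1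

theorem pair_exists (M : Mod A) (a b : M.U) : ∃ p, Fst A M p a ∧ Snd A M p b := by
  by_cases ht : ∀ x, x = b
  · have ht' : ∀ x y : M.U, x = y := fun x y => (ht x).trans (ht y).symm
    have hs : ∀ y, Sing A M y := fun y u u' _ _ => ht' _ _
    have hR : ∀ x y, M.R x y := fun x y => by
      obtain ⟨c, hc⟩ := M.pst x x
      have := (hc x).2 (Or.inl rfl)
      rwa [ht' c y] at this
    have h1 : ∀ x y, Q1 A M x y := fun x y => ⟨x, ⟨hR _ _, hs _⟩, hR _ _⟩
    exact ⟨a, ⟨h1 _ _, fun _ _ _ _ => ht' _ _⟩,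
      ⟨⟨a, ⟨hR _ _, Or.inr hs⟩, h1 _ _⟩, fun _ _ _ _ => ht' _ _⟩⟩
  · push Not at ht
    obtain ⟨x, hx⟩ := ht
    obtain ⟨sa, hsa⟩ := M.pst a a
    obtain ⟨sb, hsb⟩ := M.pst b b
    obtain ⟨bx, hbx⟩ := M.pst b x
    obtain ⟨q, hq⟩ := M.pst sb bx
    obtain ⟨p, hp⟩ := M.pst sa q
    simp only [or_self] at hsa hsb
    have Ssa : Sing A M sa := fun u u' h1 h2 => by
      rw [(hsa u).1 h1, (hsa u').1 h2]
    have Ssb : Sing A M sb := fun u u' h1 h2 => by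
      rw [(hsb u).1 h1, (hsb u').1 h2]
    have Nbx : ¬ Sing A M bx := fun h =>
      hx (h x b ((hbx x).2 (Or.inr rfl)) ((hbx b).2 (Or.inl rfl)))
    have hne : sb ≠ bx := by rintro rfl; exact Nbx Ssb
    have Nq : ¬ Sing A M q := fun h =>
      hne (h _ _ ((hq sb).2 (Or.inl rfl)) ((hq bx).2 (Or.inr rfl)))
    have TN : ∀ y, T2 A M y → ¬ Sing A M y := by
      rintro y (h | h)
      · exact h
      · exact absurd (h _) Nq
    have q1q : ∀ u, Q1 A M q u → u = b := by
      rintro u ⟨v, ⟨h1, h2⟩, h3⟩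
      rcases (hq v).1 h1 with rfl | rfl
      · exact (hsb u).1 h3
      · exact absurd h2 Nbx
    have q1p : ∀ u, Q1 A M p u → u = a := by
      rintro u ⟨v, ⟨h1, h2⟩, h3⟩
      rcases (hp v).1 h1 with rfl | rfl
      · exact (hsa u).1 h3
      · exact absurd h2 Nq
    have q2p : ∀ u, Q2 A M p u → u = b := by
      rintro u ⟨v, ⟨h1, h2⟩, h3⟩
      rcases (hp v).1 h1 with rfl | rfl
      · exact absurd Ssa (TN _ h2)
      · exact q1q u h3
    refine ⟨p, ⟨⟨sa, ⟨(hp _).2 (Or.inl rfl), Ssa⟩, (hsa _).2 rfl⟩, ?_⟩,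
      ⟨⟨q, ⟨(hp _).2 (Or.inr rfl), Or.inl Nq⟩, sb, ⟨(hq _).2 (Or.inl rfl), Ssb⟩,
        (hsb _).2 rfl⟩, ?_⟩⟩
    · intro u u' h1 h2; rw [q1p u h1, q1p u' h2]
    · intro u u' h1 h2; rw [q2p u h1, q2p u' h2]

theorem Func.comp {Q Q' : BRel A} (hQ : Func Q) (hQ' : Func Q') :
    Func (A := A) (fun M z u => ∃ v, Q M z v ∧ Q' M v u) := by
  rintro M z u u' ⟨v, h1, h2⟩ ⟨v', h3, h4⟩
  obtain rfl := hQ _ _ _ _ h1 h3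
  exact hQ' _ _ _ _ h2 h4

def Dec (A : DAlg n) : ℕ → BRel A
  | 0 => Fst A
  | k + 1 => fun M z u => ∃ v, Snd A M z v ∧ Dec A k M v u

theorem mov_Dec (hn : 3 ≤ n) : ∀ k, Mov (Dec A k)
  | 0 => mov_Fst hn
  | k + 1 => (mov_Snd hn).comp (mov_Dec hn k)

theorem func_Dec : ∀ k, Func (Dec A k)
  | 0 => func_Fst
  | k + 1 => func_Snd.comp (func_Dec k)

open Classical in
theorem code_exists (M : Mod A) (o : M.U) (L : List M.U) :
    ∃ w, ∀ a ∈ L, Dec A (L.idxOf a) M w a := by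
  induction L with
  | nil => exact ⟨o, by simp⟩
  | cons b L ih =>
    obtain ⟨w, hw⟩ := ih
    obtain ⟨p, h1, h2⟩ := pair_exists M b w
    refine ⟨p, fun a ha => ?_⟩
    by_cases hab : a = b
    · subst hab; simpa [Dec] using h1
    · have : a ∈ L := by simpa [hab] using ha
      rw [List.idxOf_cons_ne _ (Ne.symm hab)]
      exact ⟨w, h2, hw a this⟩

def EncL (M : Mod A) (s : Fin n → M.U) : List (Fin n) → M.U → M.U → Prop
  | [], a, u => u = a
  | j :: js, a, u => ∃ p, (Fst A M p a ∧ Snd A M p (s j)) ∧ EncL M s js p u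

theorem EncL_congr (M : Mod A) (s s' : Fin n → M.U) (js : List (Fin n)) :
    ∀ (_ : ∀ j ∈ js, s j = s' j) (a u : M.U), EncL M s js a u ↔ EncL M s' js a u := by
  induction js with
  | nil => intro _ a u; rfl
  | cons j js ih =>
    intro h a u
    simp only [EncL, h j (by simp), ih (fun j hj => h j (by simp [hj]))]

theorem EncL_exists (M : Mod A) (s : Fin n → M.U) (js : List (Fin n)) :
    ∀ a, ∃ u, EncL M s js a u := by
  induction js with
  | nil => intro a; exact ⟨a, rfl⟩
  | cons j js ih =>
    intro a
    obtain ⟨p, hp⟩ := pair_exists M a (s j)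
    obtain ⟨u, hu⟩ := ih p
    exact ⟨u, p, hp, hu⟩

theorem rep_encL (hn : 3 ≤ n) (i : Fin n) (js : List (Fin n)) :
    ∀ (_ : i ∉ js) (P : Pred A), Rep P →
      Rep (A := A) (fun M s => ∃ u, EncL M s js (s i) u ∧ P M (update s i u)) := by
  induction js with
  | nil => intro _ P hP; exact hP.congr fun M s => by simp [EncL]
  | cons j js ih =>
    intro hi P hP
    simp only [List.mem_cons, not_or] at hi
    refine (mov_FstInv hn i _ (((mov_Snd hn).rel hi.1).and (ih hi.2 P hP))).congr fun M s => ?_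
    have key : ∀ p u, EncL M (update s i p) js p u ↔ EncL M s js p u := fun p u =>
      EncL_congr M _ _ js (fun j' hj' => by
        have hne : j' ≠ i := by rintro rfl; exact hi.2 hj'
        simp [update_of_ne hne]) p u
    simp only [update_self, update_idem, update_of_ne (Ne.symm hi.1), key, EncL]
    constructor
    · rintro ⟨p, h1, h2, u, h3, h4⟩; exact ⟨u, ⟨p, ⟨h1, h2⟩, h3⟩, h4⟩
    · rintro ⟨u, ⟨p, ⟨h1, h2⟩, h3⟩, h4⟩; exact ⟨p, h1, h2, u, h3, h4⟩

theorem decL0 (hn : 3 ≤ n) (js : List (Fin n)) : ∃ Q : BRel A, Mov Q ∧ Func Q ∧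
    ∀ M s a u, EncL M s js a u → Q M u a := by
  induction js with
  | nil => exact ⟨fun M z u => u = z, mov_eq, fun M z u u' h h' => h.trans h'.symm,
      fun M s a u h => h.symm⟩
  | cons j js ih =>
    obtain ⟨Q, h1, h2, h3⟩ := ih
    refine ⟨_, h1.comp (mov_Fst hn), h2.comp func_Fst, ?_⟩
    rintro M s a u ⟨p, hp, hu⟩
    exact ⟨p, h3 _ _ _ _ hu, hp.1⟩

theorem decL (hn : 3 ≤ n) (js : List (Fin n)) : ∀ j ∈ js, ∃ Q : BRel A, Mov Q ∧ Func Q ∧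
    ∀ M s a u, EncL M s js a u → Q M u (s j) := by
  induction js with
  | nil => simp
  | cons k js ih =>
    intro j hj
    by_cases h : j ∈ js
    · obtain ⟨Q, h1, h2, h3⟩ := ih j h
      refine ⟨Q, h1, h2, ?_⟩
      rintro M s a u ⟨p, hp, hu⟩
      exact h3 _ _ _ _ hu
    · obtain rfl : j = k := by simpa [h] using hj
      obtain ⟨Q, h1, h2, h3⟩ := decL0 (A := A) hn js
      refine ⟨_, h1.comp (mov_Snd hn), h2.comp func_Snd, ?_⟩
      rintro M s a u ⟨p, hp, hu⟩
      exact ⟨p, h3 _ _ _ _ hu, hp.2⟩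

theorem rep_const {P : Pred A} (hP : Rep P) (i : Fin n) :
    Rep (A := A) (fun M s => P M (fun _ => s i)) := by
  classical
  have key : ∀ S : Finset (Fin n),
      Rep (A := A) (fun M s => P M (fun j => if j ∈ S then s i else s j)) := by
    intro S
    induction S using Finset.induction_on with
    | empty => simpa using hP
    | insert k S hk ih =>
      by_cases hki : k = i
      · subst hki
        refine ih.congr fun M s => iff_of_eq (congrArg _ (funext fun j => ?_))
        by_cases h : j = k <;> simp [h]
      · refine (((rep_eq k i).and ih).ex k).congr fun M s => ?_
        simp only [update_self, update_of_ne (Ne.symm hki), exists_eq_left]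
        refine iff_of_eq (congrArg _ (funext fun j => ?_))
        by_cases h : j = k
        · subst h; simp [hk]
        · simp [h]
  simpa using key Finset.univ

/-- encoding of `n`-tuples -/
theorem encode (hn : 3 ≤ n) (A : DAlg n) :
    ∃ (E : ∀ M : Mod A, (Fin n → M.U) → M.U → Prop) (D : Fin n → BRel A),
      (∀ j, Mov (D j)) ∧ (∀ j, Func (D j)) ∧ (∀ M s, ∃ u, E M s u) ∧
      (∀ M s u, E M s u → ∀ j, D j M u (s j)) ∧
      (∀ P : Pred A, Rep P → Rep (A := A) (fun M s => ∃ u, E M s u ∧ P M (fun _ => u))) := by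
  classical
  let i : Fin n := ⟨0, by omega⟩
  let js : List (Fin n) := (Finset.univ.filter (· ≠ i)).toList
  have hi : i ∉ js := by simp [js]
  have hD : ∀ j, ∃ Q : BRel A, Mov Q ∧ Func Q ∧
      ∀ M s u, EncL M s js (s i) u → Q M u (s j) := by
    intro j
    by_cases h : j = i
    · subst h
      obtain ⟨Q, h1, h2, h3⟩ := decL0 (A := A) hn js
      exact ⟨Q, h1, h2, fun M s u h => h3 _ _ _ _ h⟩
    · obtain ⟨Q, h1, h2, h3⟩ := decL (A := A) hn js j (by simp [js, h])
      exact ⟨Q, h1, h2, fun M s u h => h3 _ _ _ _ h⟩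
  choose D h1 h2 h3 using hD
  refine ⟨fun M s u => EncL M s js (s i) u, D, h1, h2, fun M s => EncL_exists M s js _,
    fun M s u h j => h3 j M s u h, fun P hP => ?_⟩
  refine (rep_encL hn i js hi _ (rep_const hP i)).congr fun M s => ?_
  simp only [update_self]

theorem rep_move {P : Pred A} (hP : Rep P) (Q : Fin n → BRel A) (hQ : ∀ j, Mov (Q j)) :
    Rep (A := A) (fun M s => ∃ a, (∀ j, Q j M (s j) (a j)) ∧ P M a) := by
  classical
  have key : ∀ S : Finset (Fin n),
      Rep (A := A) (fun M s => ∃ a, (∀ j, if j ∈ S then Q j M (s j) (a j) else a j = s j) ∧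
        P M a) := by
    intro S
    induction S using Finset.induction_on with
    | empty =>
      refine hP.congr fun M s => ?_
      simp only [Finset.notMem_empty, if_false]
      constructor
      · intro h; exact ⟨s, fun _ => rfl, h⟩
      · rintro ⟨a, h, h'⟩; obtain rfl : a = s := funext h
        exact h'
    | insert k S hk ih =>
      refine (hQ k k _ ih).congr fun M s => ?_
      constructor
      · rintro ⟨u, hu, a, ha, hPa⟩
        refine ⟨a, fun j => ?_, hPa⟩
        have := ha j
        by_cases h : j = k
        · subst h; simp [hk] at this; simpa [this] using hu
        · simpa [h] using this
      · rintro ⟨a, ha, hPa⟩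
        refine ⟨a k, by simpa using ha k, a, fun j => ?_, hPa⟩
        have := ha j
        by_cases h : j = k
        · subst h; simp [hk]
        · simpa [h] using this
  simpa using key Finset.univ

theorem rep_spread {P : Pred A} (hP : Rep P) (i : Fin n) (Q : Fin n → BRel A)
    (hQ : ∀ j, Mov (Q j)) :
    Rep (A := A) (fun M s => ∃ a, (∀ j, Q j M (s i) (a j)) ∧ P M a) :=
  rep_const (rep_move hP Q hQ) i

theorem rep_ball {ι : Type} (S : Finset ι) (P : ι → Pred A) (hP : ∀ k ∈ S, Rep (P k)) (i : Fin n) :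
    Rep (A := A) (fun M s => ∀ k ∈ S, P k M s) := by
  classical
  induction S using Finset.induction_on with
  | empty => exact (rep_eq i i).congr fun M s => by simp
  | insert k S hk ih =>
    refine ((hP k (by simp)).and (ih fun k hk => hP k (by simp [hk]))).congr fun M s => ?_
    simp

end DCA
namespace DCA

open Function Filter

variable {n : ℕ} {A B C : DAlg n}

theorem Rep.transfer {P : Pred C} (hP : Rep P) {M N : Mod C} {s : Fin n → M.U} {t : Fin n → N.U}
    (h : ∀ x, M.h x s ↔ N.h x t) : P M s ↔ P N t := by
  obtain ⟨x, hx⟩ := hP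
  rw [← hx, ← hx, h]

theorem local_lemma (hn : 3 ≤ n) (N : Mod C) (c' : N.U) (Φ : Finset (C.carrier × (Fin n → N.U)))
    (hΦ : ∀ φ ∈ Φ, N.h φ.1 φ.2) :
    ∃ P : Pred C, Rep P ∧ P N (fun _ => c') ∧
      ∀ (M : Mod C) (c : M.U), P M (fun _ => c) →
        ∃ v : N.U → M.U, v c' = c ∧ ∀ φ ∈ Φ, M.h φ.1 (v ∘ φ.2) := by
  classical
  let L : List N.U := c' :: Φ.toList.flatMap (fun φ => List.ofFn φ.2)
  have hL : ∀ φ ∈ Φ, ∀ j, φ.2 j ∈ L := by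
    intro φ hφ j
    refine List.mem_cons_of_mem _ (List.mem_flatMap.2 ⟨φ, by simpa using hφ, ?_⟩)
    simp
  have hc : c' ∈ L := by simp [L]
  obtain ⟨w, hw⟩ := code_exists N c' L
  let i0 : Fin n := ⟨0, by omega⟩
  let i1 : Fin n := ⟨1, by omega⟩
  have h01 : i0 ≠ i1 := by simp [i0, i1]
  let P : Pred C := fun M s => ∃ z, Dec C (L.idxOf c') M z (s i0) ∧
    ∀ φ ∈ Φ, ∃ a : Fin n → M.U, (∀ j, Dec C (L.idxOf (φ.2 j)) M z (a j)) ∧ M.h φ.1 a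
  refine ⟨P, ?_, ⟨w, hw _ hc, fun φ hφ => ⟨φ.2, fun j => hw _ (hL φ hφ j), hΦ φ hφ⟩⟩, ?_⟩
  · refine ((((mov_Dec hn (L.idxOf c')).rel h01.symm).and
      (rep_ball Φ _ (fun φ _ => rep_spread (rep_h φ.1) i1 (fun j => Dec C (L.idxOf (φ.2 j)))
        (fun j => mov_Dec hn _)) i1)).ex i1).congr fun M s => ?_
    simp only [update_self, update_of_ne h01, P]
  · rintro M c ⟨z, hz, h⟩
    let v : N.U → M.U := fun a => if h : ∃ b, Dec C (L.idxOf a) M z b then h.choose else z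
    have hv : ∀ a b, Dec C (L.idxOf a) M z b → v a = b := by
      intro a b hb
      have hex : ∃ b, Dec C (L.idxOf a) M z b := ⟨b, hb⟩
      simp only [v, dif_pos hex]
      exact func_Dec _ _ _ _ _ hex.choose_spec hb
    refine ⟨v, hv _ _ hz, fun φ hφ => ?_⟩
    obtain ⟨a, ha, hx⟩ := h φ hφ
    have : v ∘ φ.2 = a := funext fun j => hv _ _ (ha j)
    rw [this]; exact hx

/-- finite consistency for the base step -/
theorem local_base (hn : 3 ≤ n) (M N : Mod C) (s : Fin n → M.U) (t : Fin n → N.U)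
    (hst : ∀ x, M.h x s ↔ N.h x t)
    (Φ : Finset (C.carrier × (Fin n → N.U))) (hΦ : ∀ φ ∈ Φ, N.h φ.1 φ.2) :
    ∃ v : N.U → M.U, (∀ j, v (t j) = s j) ∧ ∀ φ ∈ Φ, M.h φ.1 (v ∘ φ.2) := by
  classical
  obtain ⟨E, D, hD1, hD2, hE, hED, hrep⟩ := encode hn C
  obtain ⟨u', hu'⟩ := hE N t
  let i0 : Fin n := ⟨0, by omega⟩
  let i1 : Fin n := ⟨1, by omega⟩
  have h01 : i0 ≠ i1 := by simp [i0, i1]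
  choose d hd using fun j => (hD1 j).rel h01
  let tup : Fin n → Fin n → N.U := fun j => update (fun _ => t j) i0 u'
  obtain ⟨P, hP, hPN, hPM⟩ := local_lemma hn N u'
    (Φ ∪ Finset.univ.image (fun j => (d j, tup j))) (by
      intro φ hφ
      rcases Finset.mem_union.1 hφ with h | h
      · exact hΦ φ h
      · obtain ⟨j, -, rfl⟩ := Finset.mem_image.1 h
        refine (hd j N _).2 ?_
        simpa [tup, update_of_ne h01.symm] using hED _ _ _ hu' j)
  obtain ⟨u, hu, hPu⟩ := ((hrep P hP).transfer hst).2 ⟨u', hu', hPN⟩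
  obtain ⟨v, hv, hvΦ⟩ := hPM M u hPu
  refine ⟨v, fun j => ?_, fun φ hφ => hvΦ φ (Finset.mem_union_left _ hφ)⟩
  have := hvΦ (d j, tup j) (Finset.mem_union_right _ (Finset.mem_image_of_mem _ (Finset.mem_univ j)))
  have := (hd j M _).1 this
  simp only [tup, comp_apply, update_self, update_of_ne h01.symm, hv] at this
  exact hD2 j _ _ _ _ this (hED _ _ _ hu j)

/-- finite consistency for the chain step -/
theorem local_step (hn : 3 ≤ n) (M N : Mod C) (e : M.U → N.U)
    (he : ∀ x s, M.h x s ↔ N.h x (e ∘ s)) (o : M.U)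
    (Φ : Finset (C.carrier × (Fin n → N.U))) (hΦ : ∀ φ ∈ Φ, N.h φ.1 φ.2) (K : Finset M.U) :
    ∃ v : N.U → M.U, (∀ a ∈ K, v (e a) = a) ∧ ∀ φ ∈ Φ, M.h φ.1 (v ∘ φ.2) := by
  classical
  obtain ⟨c, hc⟩ := code_exists M o K.toList
  let i0 : Fin n := ⟨0, by omega⟩
  let i1 : Fin n := ⟨1, by omega⟩
  have h01 : i0 ≠ i1 := by simp [i0, i1]
  choose d hd using fun k => (mov_Dec (A := C) hn k).rel h01
  let tup : M.U → Fin n → M.U := fun a => update (fun _ => a) i0 c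
  let fct : M.U → C.carrier × (Fin n → N.U) := fun a => (d (K.toList.idxOf a), e ∘ tup a)
  obtain ⟨P, hP, hPN, hPM⟩ := local_lemma hn N (e c) (Φ ∪ K.image fct) (by
      intro φ hφ
      rcases Finset.mem_union.1 hφ with h | h
      · exact hΦ φ h
      · obtain ⟨a, ha, rfl⟩ := Finset.mem_image.1 h
        refine (he _ _).1 ((hd _ M _).2 ?_)
        simpa [tup, update_of_ne h01.symm] using hc a (by simpa using ha))
  have hPc : P M (fun _ => c) := (hP.transfer (fun x => he x (fun _ => c))).2 hPN
  obtain ⟨v, hv, hvΦ⟩ := hPM M c hPc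
  refine ⟨v, fun a ha => ?_, fun φ hφ => hvΦ φ (Finset.mem_union_left _ hφ)⟩
  have := hvΦ (fct a) (Finset.mem_union_right _ (Finset.mem_image_of_mem _ ha))
  have := (hd _ M _).1 this
  simp only [fct, tup, comp_apply, update_self, update_of_ne h01.symm, hv] at this
  exact func_Dec _ _ _ _ _ this (hc a (by simpa using ha))

/-! Quotients -/

structure PreBase (U : Type) (E R : U → U → Prop) : Prop where
  eqv : Equivalence E
  congR : ∀ a a' b b', E a a' → E b b' → R a b → R a' b'
  pst : ∀ a b, ∃ c, ∀ d, R d c ↔ E d a ∨ E d b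
  ext : ∀ a b, (∀ z, R z a ↔ R z b) → E a b

structure PreRep (A : DAlg n) (U : Type) (E R : U → U → Prop)
    (h : A.carrier → (Fin n → U) → Prop) : Prop where
  cong : ∀ x s s', (∀ j, E (s j) (s' j)) → h x s → h x s'
  h_inf : ∀ x y s, h (A.str.inf x y) s ↔ h x s ∧ h y s
  h_compl : ∀ x s, h (A.str.compl x) s ↔ ¬ h x s
  h_cylu : ∀ i x s, h (A.str.cylu i x) s ↔ ∃ u, R u (s i) ∧ h x (update s i u)
  h_cyld : ∀ i x s, h (A.str.cyld i x) s ↔ ∃ u, R (s i) u ∧ h x (update s i u)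
  h_diag : ∀ i j s, h (A.str.diag i j) s ↔ E (s i) (s j)

/-- Quotient model. -/
noncomputable def quotMod {U : Type} {E R : U → U → Prop} (b : PreBase U E R)
    {h : A.carrier → (Fin n → U) → Prop} (r : PreRep A U E R h) : Mod A :=
  letI S : Setoid U := ⟨E, b.eqv⟩
  have hout : ∀ u : U, E (Quotient.out (Quotient.mk S u)) u := fun u => Quotient.mk_out (s := S) u
  have oeo : ∀ a c : Quotient S, E a.out c.out ↔ a = c := fun a c =>
    ⟨fun h => by
      rw [← Quotient.out_eq a, ← Quotient.out_eq c]
      exact Quotient.sound h, fun h => by rw [h]; exact b.eqv.refl _⟩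
  have hupd : ∀ (x : A.carrier) (s : Fin n → Quotient S) (i : Fin n) (u : U),
      h x (fun j => (update s i (Quotient.mk S u) j).out) ↔
        h x (update (fun j => (s j).out) i u) := by
    intro x s i u
    have key : ∀ j, E ((update s i (Quotient.mk S u) j).out)
        (update (fun j => (s j).out) i u j) := by
      intro j
      by_cases hj : j = i
      · subst hj; simpa using hout u
      · simpa [update_of_ne hj] using b.eqv.refl _
    exact ⟨r.cong x _ _ key, r.cong x _ _ (fun j => b.eqv.symm (key j))⟩
  { U := Quotient S
    R := fun a b => R a.out b.out
    h := fun x s => h x (fun j => (s j).out)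
    pst := by
      intro a a'
      obtain ⟨c, hc⟩ := b.pst a.out a'.out
      refine ⟨Quotient.mk S c, fun d => ?_⟩
      have h1 : R d.out (Quotient.mk S c).out ↔ R d.out c :=
        ⟨b.congR _ _ _ _ (b.eqv.refl _) (hout c),
          b.congR _ _ _ _ (b.eqv.refl _) (b.eqv.symm (hout c))⟩
      refine h1.trans ((hc _).trans ?_)
      exact or_congr (oeo _ _) (oeo _ _)
    ext := by
      intro a a' hz
      refine (oeo _ _).1 (b.ext _ _ fun z => ?_)
      have := hz (Quotient.mk S z)
      have h1 : ∀ w, R (Quotient.mk S z).out w ↔ R z w := fun w =>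
        ⟨b.congR _ _ _ _ (hout z) (b.eqv.refl _),
          b.congR _ _ _ _ (b.eqv.symm (hout z)) (b.eqv.refl _)⟩
      exact (h1 _).symm.trans (this.trans (h1 _))
    h_inf := fun x y s => r.h_inf x y _
    h_compl := fun x s => r.h_compl x _
    h_cylu := by
      intro i x s
      rw [r.h_cylu]
      constructor
      · rintro ⟨u, h1, h2⟩
        exact ⟨Quotient.mk S u, b.congR _ _ _ _ (b.eqv.symm (hout u)) (b.eqv.refl _) h1,
          (hupd x s i u).2 h2⟩
      · rintro ⟨u, h1, h2⟩
        refine ⟨u.out, h1, (hupd x s i u.out).1 ?_⟩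
        rwa [Quotient.out_eq]
    h_cyld := by
      intro i x s
      rw [r.h_cyld]
      constructor
      · rintro ⟨u, h1, h2⟩
        exact ⟨Quotient.mk S u, b.congR _ _ _ _ (b.eqv.refl _) (b.eqv.symm (hout u)) h1,
          (hupd x s i u).2 h2⟩
      · rintro ⟨u, h1, h2⟩
        refine ⟨u.out, h1, (hupd x s i u.out).1 ?_⟩
        rwa [Quotient.out_eq]
    h_diag := by
      intro i j s
      rw [r.h_diag]
      exact oeo _ _ }

def quotMk {U : Type} {E R : U → U → Prop} (b : PreBase U E R)
    {h : A.carrier → (Fin n → U) → Prop} (r : PreRep A U E R h) (u : U) : (quotMod b r).U :=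
  Quotient.mk ⟨E, b.eqv⟩ u

theorem quotMk_eq {U : Type} {E R : U → U → Prop} (b : PreBase U E R)
    {h : A.carrier → (Fin n → U) → Prop} (r : PreRep A U E R h) (u u' : U) :
    quotMk b r u = quotMk b r u' ↔ E u u' :=
  Quotient.eq (r := ⟨E, b.eqv⟩)

theorem quotMk_h {U : Type} {E R : U → U → Prop} (b : PreBase U E R)
    {h : A.carrier → (Fin n → U) → Prop} (r : PreRep A U E R h) (x : A.carrier)
    (s : Fin n → U) :
    (quotMod b r).h x (fun j => quotMk b r (s j)) ↔ h x s := by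
  have key : ∀ j, E (Quotient.out (Quotient.mk ⟨E, b.eqv⟩ (s j))) (s j) := fun j =>
    Quotient.mk_out (s := ⟨E, b.eqv⟩) (s j)
  exact ⟨r.cong x _ _ key, r.cong x _ _ (fun j => b.eqv.symm (key j))⟩

/-! Ultraproducts -/

theorem ultraproduct {I : Type} (F : Ultrafilter I) (M : I → Mod A) :
    ∃ (M' : Mod A) (q : (∀ i, (M i).U) → M'.U),
      (∀ a b, q a = q b ↔ ∀ᶠ i in (F : Filter I), a i = b i) ∧
      (∀ x (s : Fin n → ∀ i, (M i).U), M'.h x (fun j => q (s j)) ↔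
        ∀ᶠ i in (F : Filter I), (M i).h x (fun j => s j i)) := by
  classical
  let U := ∀ i, (M i).U
  let E : U → U → Prop := fun a b => ∀ᶠ i in (F : Filter I), a i = b i
  let R : U → U → Prop := fun a b => ∀ᶠ i in (F : Filter I), (M i).R (a i) (b i)
  let h : A.carrier → (Fin n → U) → Prop := fun x s =>
    ∀ᶠ i in (F : Filter I), (M i).h x (fun j => s j i)
  have hu : ∀ (s : Fin n → U) (k : Fin n) (u : U) (i : I),
      (fun j => update s k u j i) = update (fun j => s j i) k (u i) := by
    intro s k u i
    funext j
    by_cases hj : j = k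
    · subst hj; simp
    · simp [update_of_ne hj]
  have b : PreBase U E R := by
    refine ⟨⟨fun a => Eventually.of_forall fun _ => rfl, fun h => h.mono fun _ h => h.symm,
      fun h h' => by filter_upwards [h, h'] with i h h' using h.trans h'⟩, ?_, ?_, ?_⟩
    · intro a a' b b' h1 h2 h3
      filter_upwards [h1, h2, h3] with i h1 h2 h3
      rwa [← h1, ← h2]
    · intro a b
      choose c hc using fun i => (M i).pst (a i) (b i)
      refine ⟨c, fun d => ?_⟩
      simp only [R, E, hc, Ultrafilter.eventually_or]
    · intro a b hz
      by_contra hne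
      have hne : ∀ᶠ i in (F : Filter I), ¬ a i = b i := Ultrafilter.eventually_not.2 hne
      have : ∀ i, ∃ z, ¬ a i = b i → ¬ ((M i).R z (a i) ↔ (M i).R z (b i)) := by
        intro i
        by_cases hi : a i = b i
        · exact ⟨a i, fun h => absurd hi h⟩
        · by_contra! hcon
          exact hi ((M i).ext _ _ fun z => (hcon z).2)
      choose z hz' using this
      have h1 : ∀ᶠ i in (F : Filter I), ¬ ((M i).R (z i) (a i) ↔ (M i).R (z i) (b i)) :=
        hne.mono hz'
      by_cases h2 : R z a
      · have h3 := (hz z).1 h2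
        have : ∀ᶠ i in (F : Filter I), False := by
          filter_upwards [h1, h2, h3] with i h1 h2 h3
          exact h1 ⟨fun _ => h3, fun _ => h2⟩
        exact F.neBot.ne (by simpa using this)
      · have h3 := fun h => h2 ((hz z).2 h)
        have h2 := Ultrafilter.eventually_not.2 h2
        have h3 := Ultrafilter.eventually_not.2 h3
        have : ∀ᶠ i in (F : Filter I), False := by
          filter_upwards [h1, h2, h3] with i h1 h2 h3
          exact h1 ⟨fun h => absurd h h2, fun h => absurd h h3⟩
        exact F.neBot.ne (by simpa using this)
  have r : PreRep A U E R h := by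
    refine ⟨?_, ?_, ?_, ?_, ?_, ?_⟩
    · intro x s s' hs h1
      have hs : ∀ᶠ i in (F : Filter I), ∀ j, s j i = s' j i := eventually_all.2 hs
      filter_upwards [hs, h1] with i h1 h2
      simpa only [h1] using h2
    · intro x y s
      simp only [h, Mod.h_inf, eventually_and]
    · intro x s
      simp only [h, Mod.h_compl, Ultrafilter.eventually_not]
    · intro k x s
      simp only [h, Mod.h_cylu, R, hu]
      constructor
      · intro h1
        have : ∀ i, ∃ u, (∃ u, (M i).R u (s k i) ∧ (M i).h x (update (fun j => s j i) k u)) →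
            (M i).R u (s k i) ∧ (M i).h x (update (fun j => s j i) k u) := by
          intro i
          by_cases hi : ∃ u, (M i).R u (s k i) ∧ (M i).h x (update (fun j => s j i) k u)
          · obtain ⟨u, hu⟩ := hi; exact ⟨u, fun _ => hu⟩
          · exact ⟨s k i, fun h => absurd h hi⟩
        choose u hu using this
        exact ⟨u, h1.mono fun i hi => (hu i hi).1, h1.mono fun i hi => (hu i hi).2⟩
      · rintro ⟨u, h1, h2⟩
        filter_upwards [h1, h2] with i h1 h2 using ⟨u i, h1, h2⟩
    · intro k x s
      simp only [h, Mod.h_cyld, R, hu]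
      constructor
      · intro h1
        have : ∀ i, ∃ u, (∃ u, (M i).R (s k i) u ∧ (M i).h x (update (fun j => s j i) k u)) →
            (M i).R (s k i) u ∧ (M i).h x (update (fun j => s j i) k u) := by
          intro i
          by_cases hi : ∃ u, (M i).R (s k i) u ∧ (M i).h x (update (fun j => s j i) k u)
          · obtain ⟨u, hu⟩ := hi; exact ⟨u, fun _ => hu⟩
          · exact ⟨s k i, fun h => absurd h hi⟩
        choose u hu using this
        exact ⟨u, h1.mono fun i hi => (hu i hi).1, h1.mono fun i hi => (hu i hi).2⟩
      · rintro ⟨u, h1, h2⟩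
        filter_upwards [h1, h2] with i h1 h2 using ⟨u i, h1, h2⟩
    · intro i j s
      simp only [h, Mod.h_diag, E]
  exact ⟨quotMod b r, quotMk b r, quotMk_eq b r, quotMk_h b r⟩

theorem compactness {ι : Type} [Nonempty ι] (Γ : ι → A.carrier)
    (hdir : ∀ i j, ∃ k, ∀ (M : Mod A) s, M.h (Γ k) s → M.h (Γ i) s ∧ M.h (Γ j) s)
    (hreal : ∀ i, ∃ (M : Mod A) (s : _), M.h (Γ i) s) :
    ∃ (M : Mod A) (s : _), ∀ i, M.h (Γ i) s := by
  classical
  have h1 : ∀ S : Finset ι, ∃ k, ∀ i ∈ S, ∀ (M : Mod A) s, M.h (Γ k) s → M.h (Γ i) s := by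
    intro S
    induction S using Finset.induction_on with
    | empty => exact ⟨Classical.arbitrary ι, by simp⟩
    | insert i S hi ih =>
      obtain ⟨k, hk⟩ := ih
      obtain ⟨l, hl⟩ := hdir i k
      refine ⟨l, fun j hj M s h => ?_⟩
      rcases Finset.mem_insert.1 hj with rfl | hj
      · exact (hl M s h).1
      · exact hk j hj M s (hl M s h).2
  have h2 : ∀ S : Finset ι, ∃ (M : Mod A) (s : Fin n → M.U), ∀ i ∈ S, M.h (Γ i) s := by
    intro S
    obtain ⟨k, hk⟩ := h1 S
    obtain ⟨M, s, h⟩ := hreal k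
    exact ⟨M, s, fun i hi => hk i hi M s h⟩
  choose M s hs using h2
  obtain ⟨M', q, -, hq⟩ := ultraproduct (Ultrafilter.of (atTop : Filter (Finset ι))) M
  refine ⟨M', fun j => q (fun S => s S j), fun i => (hq _ _).2 ?_⟩
  refine (Ultrafilter.of_le _) ?_
  filter_upwards [eventually_ge_atTop ({i} : Finset ι)] with S hS
  exact hs S i (hS (by simp))

/-- extension from finite consistency -/
theorem extend {J : Type} {f : C.carrier → A.carrier} (hf : DHom C A f) (M : Mod A) (N : Mod C)
    (α : J → M.U) (β : J → N.U)
    (hloc : ∀ (Φ : Finset (C.carrier × (Fin n → N.U))) (K : Finset J),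
      (∀ φ ∈ Φ, N.h φ.1 φ.2) →
      ∃ v : N.U → M.U, (∀ j ∈ K, v (β j) = α j) ∧ ∀ φ ∈ Φ, M.h (f φ.1) (v ∘ φ.2)) :
    ∃ (M' : Mod A) (d : N.U → M'.U),
      (∀ x s, N.h x s ↔ M'.h (f x) (d ∘ s)) ∧
      (∀ x (s : Fin n → J), M.h x (α ∘ s) ↔ M'.h x (d ∘ β ∘ s)) := by
  classical
  let I := Finset (C.carrier × (Fin n → N.U)) × Finset J
  have : ∀ i : I, ∃ v : N.U → M.U, (∀ j ∈ i.2, v (β j) = α j) ∧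
      ∀ φ ∈ i.1, N.h φ.1 φ.2 → M.h (f φ.1) (v ∘ φ.2) := by
    intro i
    obtain ⟨v, h1, h2⟩ := hloc (i.1.filter fun φ => N.h φ.1 φ.2) i.2 (by simp)
    exact ⟨v, h1, fun φ hφ h => h2 φ (by simp [hφ, h])⟩
  choose v hv1 hv2 using this
  obtain ⟨M', q, hq1, hq2⟩ := ultraproduct (Ultrafilter.of (atTop : Filter I)) (fun _ => M)
  have hpos : ∀ x s, N.h x s → M'.h (f x) ((fun a => q (fun i => v i a)) ∘ s) := by
    intro x s hx
    refine (hq2 _ (fun j i => v i (s j))).2 ((Ultrafilter.of_le _) ?_)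
    filter_upwards [eventually_ge_atTop (({(x, s)}, ∅) : I)] with i hi
    exact hv2 i (x, s) (hi.1 (by simp)) hx
  refine ⟨M', fun a => q (fun i => v i a), fun x s => ⟨hpos x s, fun h => ?_⟩, fun x s => ?_⟩
  · by_contra hx
    have := hpos (C.str.compl x) s ((N.h_compl _ _).2 hx)
    rw [hf.2.1, M'.h_compl] at this
    exact this h
  · have h1 : ∀ j, q (fun i => v i (β (s j))) = q (fun _ => α (s j)) := by
      intro j
      refine (hq1 _ _).2 ((Ultrafilter.of_le _) ?_)
      filter_upwards [eventually_ge_atTop ((∅, {s j}) : I)] with i hi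
      exact hv1 i _ (hi.2 (by simp))
    have h2 : (fun a => q (fun i => v i a)) ∘ β ∘ s = fun j => q (fun _ => α (s j)) := funext h1
    rw [h2, hq2]
    simp [Function.comp_def]

end DCA
namespace DCA

open Function Filter

variable {n : ℕ} {A B C : DAlg n}

theorem pres_R (hn : 3 ≤ n) {M N : Mod A} {e : M.U → N.U} (he : ∀ x s, M.h x s ↔ N.h x (e ∘ s))
    (a b : M.U) : M.R a b ↔ N.R (e a) (e b) := by
  let i0 : Fin n := ⟨0, by omega⟩
  let i1 : Fin n := ⟨1, by omega⟩
  have h01 : i0 ≠ i1 := by simp [i0, i1]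
  have := ((mov_up (A := A)).rel h01).transfer (fun x => he x (update (fun _ => b) i0 a))
  simpa [update_of_ne h01.symm] using this

theorem pres_inj (hn : 3 ≤ n) {M N : Mod A} {e : M.U → N.U}
    (he : ∀ x s, M.h x s ↔ N.h x (e ∘ s))
    (a b : M.U) : a = b ↔ e a = e b := by
  let i0 : Fin n := ⟨0, by omega⟩
  let i1 : Fin n := ⟨1, by omega⟩
  have h01 : i0 ≠ i1 := by simp [i0, i1]
  have := (rep_eq (A := A) i0 i1).transfer (fun x => he x (update (fun _ => b) i0 a))
  simpa [update_of_ne h01.symm] using this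

def IsPair (M : Mod A) (a b c : M.U) : Prop := ∀ d, M.R d c ↔ d = a ∨ d = b

theorem rep_pair {i j k : Fin n} (hij : i ≠ j) (hik : i ≠ k) (hjk : j ≠ k) :
    Rep (A := A) (fun M s => IsPair M (s i) (s j) (s k)) := by
  refine (((mov_up.rel hik).and (mov_up.rel hjk)).and
    (mov_down k _ ((rep_eq k i).or (rep_eq k j)).not).not).congr fun M s => ?_
  simp only [update_self, update_of_ne hik, update_of_ne hjk, IsPair]
  push Not
  constructor
  · rintro ⟨⟨h1, h2⟩, h3⟩ d
    refine ⟨fun h => ?_, ?_⟩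
    · have := h3 d h; tauto
    · rintro (rfl | rfl) <;> assumption
  · intro h
    refine ⟨⟨(h _).2 (Or.inl rfl), (h _).2 (Or.inr rfl)⟩, fun d hd => ?_⟩
    have := (h d).1 hd; tauto

theorem pres_pair (hn : 3 ≤ n) {M N : Mod A} {e : M.U → N.U}
    (he : ∀ x s, M.h x s ↔ N.h x (e ∘ s))
    (a b c : M.U) : IsPair M a b c ↔ IsPair N (e a) (e b) (e c) := by
  let i0 : Fin n := ⟨0, by omega⟩
  let i1 : Fin n := ⟨1, by omega⟩
  let i2 : Fin n := ⟨2, by omega⟩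
  have h01 : i0 ≠ i1 := by simp [i0, i1]
  have h02 : i0 ≠ i2 := by simp [i0, i2]
  have h12 : i1 ≠ i2 := by simp [i1, i2]
  have := (rep_pair (A := A) h01 h02 h12).transfer
    (fun x => he x (update (update (fun _ => c) i0 a) i1 b))
  simpa [update_of_ne h01, update_of_ne h02.symm, update_of_ne h12.symm] using this

/-! Chains -/

theorem lift_seq (K : ℕ) : ∀ (X : ℕ → Type) (T : ∀ k, X k → X (k + 1)) (_ : X 0) (z : X K),
    ∃ a : ∀ k, X k, a K = z ∧ ∀ k ≥ K, a (k + 1) = T k (a k) := by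
  induction K with
  | zero =>
    intro X T _ z
    exact ⟨fun k => Nat.rec z (fun k x => T k x) k, rfl, fun k _ => rfl⟩
  | succ K ih =>
    intro X T o z
    obtain ⟨a, h1, h2⟩ := ih (fun k => X (k + 1)) (fun k => T (k + 1)) (T 0 o) z
    refine ⟨fun k => match k with
      | 0 => o
      | k + 1 => a k, h1, fun k hk => ?_⟩
    obtain ⟨k, rfl⟩ : ∃ l, k = l + 1 := ⟨k - 1, by omega⟩
    exact h2 k (by omega)

abbrev Lim (X : ℕ → Type) (T : ∀ k, X k → X (k + 1)) : Type :=
  {a : ∀ k, X k // ∀ᶠ k in atTop, a (k + 1) = T k (a k)}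

theorem Lim.witness {X : ℕ → Type} {T : ∀ k, X k → X (k + 1)} (o : X 0) {κ : Type} [Finite κ]
    (G : ∀ k, (κ → X k) → X k → Prop)
    (hG : ∀ k t u, G k t u → G (k + 1) (T k ∘ t) (T k u))
    (s : κ → Lim X T) (h : ∃ᶠ k in atTop, ∃ u, G k (fun j => (s j).1 k) u) :
    ∃ a : Lim X T, ∀ᶠ k in atTop, G k (fun j => (s j).1 k) (a.1 k) := by
  have hs : ∀ᶠ k in atTop, ∀ j, (s j).1 (k + 1) = T k ((s j).1 k) :=
    eventually_all.2 fun j => (s j).2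
  obtain ⟨K0, hK0⟩ := eventually_atTop.1 hs
  obtain ⟨K, hK, z, hz⟩ := frequently_atTop.1 h K0
  obtain ⟨a, ha, ha'⟩ := lift_seq K X T o z
  refine ⟨⟨a, eventually_atTop.2 ⟨K, ha'⟩⟩, eventually_atTop.2 ⟨K, fun k hk => ?_⟩⟩
  induction k, hk using Nat.le_induction with
  | base => simpa [ha] using hz
  | succ k hk ih =>
    have := hG _ _ _ ih
    have e1 : T k ∘ (fun j => (s j).1 k) = fun j => (s j).1 (k + 1) :=
      funext fun j => (hK0 k (by omega) j).symm
    simp only [e1] at this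
    simpa only [ha' k hk] using this

theorem Lim.det {X : ℕ → Type} {T : ∀ k, X k → X (k + 1)} {κ : Type} [Finite κ]
    (G : ∀ k, (κ → X k) → Prop)
    (hG : ∀ k t, G k t → G (k + 1) (T k ∘ t))
    (s : κ → Lim X T) (h : ∃ᶠ k in atTop, G k (fun j => (s j).1 k)) :
    ∀ᶠ k in atTop, G k (fun j => (s j).1 k) := by
  have hs : ∀ᶠ k in atTop, ∀ j, (s j).1 (k + 1) = T k ((s j).1 k) :=
    eventually_all.2 fun j => (s j).2
  obtain ⟨K0, hK0⟩ := eventually_atTop.1 hs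
  obtain ⟨K, hK, hz⟩ := frequently_atTop.1 h K0
  refine eventually_atTop.2 ⟨K, fun k hk => ?_⟩
  induction k, hk using Nat.le_induction with
  | base => exact hz
  | succ k hk ih =>
    have := hG _ _ ih
    have e1 : T k ∘ (fun j => (s j).1 k) = fun j => (s j).1 (k + 1) :=
      funext fun j => (hK0 k (by omega) j).symm
    simpa only [e1] using this

theorem Lim.not {X : ℕ → Type} {T : ∀ k, X k → X (k + 1)} {κ : Type} [Finite κ]
    (G : ∀ k, (κ → X k) → Prop)
    (hG : ∀ k t, G k t ↔ G (k + 1) (T k ∘ t)) (s : κ → Lim X T) :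
    (∀ᶠ k in atTop, ¬ G k (fun j => (s j).1 k)) ↔ ¬ ∀ᶠ k in atTop, G k (fun j => (s j).1 k) := by
  constructor
  · intro h1 h2
    obtain ⟨k, h1, h2⟩ := (h1.and h2).exists
    exact h1 h2
  · intro h
    exact Lim.det (fun k t => ¬ G k t) (fun k t h h' => h ((hG k t).2 h')) s
      (not_eventually.1 h)

theorem Mod.toHom (M : Mod A) :
    DHom A (fullDAlg n M.U M.R) (fun x => ({s | M.h x s} : Set (Fin n → M.U))) := by
  have key : ∀ (i : Fin n) (s z : Fin n → M.U), (∀ j, j ≠ i → s j = z j) → z = update s i (z i) := by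
    intro i s z h
    funext j
    by_cases hj : j = i
    · subst hj; simp
    · simp [update_of_ne hj, h j hj]
  refine ⟨fun x y => ?_, fun x => ?_, fun i x => ?_, fun i x => ?_, fun i j => ?_⟩
  · refine Set.ext (α := Fin n → M.U) fun s => ?_
    exact M.h_inf x y s
  · refine Set.ext (α := Fin n → M.U) fun s => ?_
    exact M.h_compl x s
  · refine Set.ext (α := Fin n → M.U) fun s => ?_
    refine (M.h_cylu i x s).trans ⟨?_, ?_⟩
    · rintro ⟨u, h1, h2⟩
      exact ⟨update s i u, h2, by simpa using h1, fun j hj => by simp [update_of_ne hj]⟩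
    · rintro ⟨z, h1, h2, h3⟩
      exact ⟨z i, h2, by rw [← key i s z h3]; exact h1⟩
  · refine Set.ext (α := Fin n → M.U) fun s => ?_
    refine (M.h_cyld i x s).trans ⟨?_, ?_⟩
    · rintro ⟨u, h1, h2⟩
      exact ⟨update s i u, h2, by simpa using h1, fun j hj => by simp [update_of_ne hj]⟩
    · rintro ⟨z, h1, h2, h3⟩
      exact ⟨z i, h2, by rw [← key i s z h3]; exact h1⟩
  · refine Set.ext (α := Fin n → M.U) fun s => ?_
    exact M.h_diag i j s

theorem limit (hn : 3 ≤ n) {f : C.carrier → A.carrier} {g : C.carrier → B.carrier}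
    (hf : DHom C A f) (hg : DHom C B g)
    (M : ℕ → Mod A) (N : ℕ → Mod B) (e : ∀ k, (M k).U → (N k).U) (d : ∀ k, (N k).U → (M (k + 1)).U)
    (heC : ∀ k x s, (M k).h (f x) s ↔ (N k).h (g x) (e k ∘ s))
    (hdC : ∀ k x s, (N k).h (g x) s ↔ (M (k + 1)).h (f x) (d k ∘ s))
    (hA : ∀ k x s, (M k).h x s ↔ (M (k + 1)).h x (d k ∘ e k ∘ s))
    (hB : ∀ k y s, (N k).h y s ↔ (N (k + 1)).h y (e (k + 1) ∘ d k ∘ s))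
    (s0 : Fin n → (M 0).U) :
    ∃ (U : Type) (R : U → U → Prop) (p : A.carrier → Set (Fin n → U))
      (q : B.carrier → Set (Fin n → U)), IsPStruct U R ∧ IsExtensional U R ∧
      DHom A (fullDAlg n U R) p ∧ DHom B (fullDAlg n U R) q ∧ (∀ c, p (f c) = q (g c)) ∧
      ∃ s : Fin n → U, (∀ x, (M 0).h x s0 → s ∈ p x) ∧
        (∀ y, (N 0).h y (e 0 ∘ s0) → s ∈ q y) := by
  let X : ℕ → Type := fun k => (M k).U
  let T : ∀ k, X k → X (k + 1) := fun k => d k ∘ e k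
  have o : X 0 := s0 ⟨0, by omega⟩
  let E : Lim X T → Lim X T → Prop := fun a b => ∀ᶠ k in atTop, a.1 k = b.1 k
  let R : Lim X T → Lim X T → Prop := fun a b => ∀ᶠ k in atTop, (M k).R (a.1 k) (b.1 k)
  have TR : ∀ k a b, (M k).R a b ↔ (M (k + 1)).R (T k a) (T k b) := fun k =>
    pres_R hn (hA k)
  have TE : ∀ k a b, a = b ↔ T k a = T k b := fun k => pres_inj hn (hA k)
  have TP : ∀ k a b c, IsPair (M k) a b c ↔ IsPair (M (k + 1)) (T k a) (T k b) (T k c) :=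
    fun k => pres_pair hn (hA k)
  have eR : ∀ k a b, (M k).R a b ↔ (N k).R (e k a) (e k b) := fun k =>
    pres_R hn (M := (M k).red hf) (N := (N k).red hg) (heC k)
  have eE : ∀ k a b, a = b ↔ e k a = e k b := fun k =>
    pres_inj hn (M := (M k).red hf) (N := (N k).red hg) (heC k)
  have dR : ∀ k a b, (N k).R a b ↔ (M (k + 1)).R (d k a) (d k b) := fun k =>
    pres_R hn (M := (N k).red hg) (N := (M (k + 1)).red hf) (hdC k)
  let pa : Lim X T → Lim X T → Bool → Lim X T := fun a b i => if i then a else b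
  have b : PreBase (Lim X T) E R := by
    refine ⟨⟨fun a => Eventually.of_forall fun _ => rfl, fun h => h.mono fun _ h => h.symm,
      fun h h' => by filter_upwards [h, h'] with i h h' using h.trans h'⟩, ?_, ?_, ?_⟩
    · intro a a' b b' h1 h2 h3
      filter_upwards [h1, h2, h3] with i h1 h2 h3
      rwa [← h1, ← h2]
    · intro a b
      obtain ⟨c, hc⟩ := Lim.witness o (fun k t u => IsPair (M k) (t true) (t false) u)
        (fun k t u => (TP k _ _ _).1) (pa a b)
        (Eventually.frequently (Eventually.of_forall fun k => (M k).pst _ _))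
      simp only [pa, if_true, Bool.false_eq_true, if_false] at hc
      refine ⟨c, fun z => ⟨fun h => ?_, ?_⟩⟩
      · have h1 : ∀ᶠ k in atTop, z.1 k = a.1 k ∨ z.1 k = b.1 k := by
          filter_upwards [hc, h] with k hc h using (hc _).1 h
        by_cases hza : E z a
        · exact Or.inl hza
        · refine Or.inr ?_
          have := (Lim.not (fun k t => t true = t false) (fun k t => TE k _ _) (pa z a)).2 hza
          filter_upwards [h1, this] with k h1 h2
          exact h1.resolve_left h2
      · rintro (h | h)
        · filter_upwards [hc, h] with k hc h using (hc _).2 (Or.inl h)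
        · filter_upwards [hc, h] with k hc h using (hc _).2 (Or.inr h)
    · intro a b hz
      by_contra hne
      have hne := (Lim.not (fun k t => t true = t false) (fun k t => TE k _ _) (pa a b)).2 hne
      obtain ⟨z, hz'⟩ := Lim.witness o
        (fun k t u => ¬ ((M k).R u (t true) ↔ (M k).R u (t false)))
        (fun k t u h => by rwa [TR, TR k u] at h) (pa a b)
        (Eventually.frequently (hne.mono fun k hk => by
          by_contra! hcon
          exact hk ((M k).ext _ _ hcon)))
      simp only [pa, if_true, Bool.false_eq_true, if_false] at hz'
      by_cases h2 : R z a
      · have h3 := (hz z).1 h2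
        obtain ⟨k, h1, h2, h3⟩ := (hz'.and (h2.and h3)).exists
        exact h1 ⟨fun _ => h3, fun _ => h2⟩
      · have h3 : ¬ R z b := fun h => h2 ((hz z).2 h)
        have h2 := (Lim.not (fun k t => (M k).R (t true) (t false))
          (fun k t => TR k _ _) (pa z a)).2 h2
        have h3 := (Lim.not (fun k t => (M k).R (t true) (t false))
          (fun k t => TR k _ _) (pa z b)).2 h3
        obtain ⟨k, h1, h2, h3⟩ := (hz'.and (h2.and h3)).exists
        exact h1 ⟨fun h => absurd h h2, fun h => absurd h h3⟩
  have hu : ∀ (s : Fin n → Lim X T) (i : Fin n) (u : Lim X T) (k : ℕ),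
      (fun j => (update s i u j).1 k) = update (fun j => (s j).1 k) i (u.1 k) := by
    intro s i u k
    funext j
    by_cases hj : j = i
    · subst hj; simp
    · simp [update_of_ne hj]
  let pA : A.carrier → (Fin n → Lim X T) → Prop := fun x s =>
    ∀ᶠ k in atTop, (M k).h x (fun j => (s j).1 k)
  let pB : B.carrier → (Fin n → Lim X T) → Prop := fun y s =>
    ∀ᶠ k in atTop, (N k).h y (e k ∘ fun j => (s j).1 k)
  have rA : PreRep A (Lim X T) E R pA := by
    refine ⟨?_, ?_, ?_, ?_, ?_, ?_⟩
    · intro x s s' hs h1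
      have hs : ∀ᶠ i in atTop, ∀ j, (s j).1 i = (s' j).1 i := eventually_all.2 hs
      filter_upwards [hs, h1] with i h1 h2
      simpa only [h1] using h2
    · intro x y s
      simp only [pA, Mod.h_inf, eventually_and]
    · intro x s
      simp only [pA, Mod.h_compl]
      exact Lim.not (fun k t => (M k).h x t) (fun k t => hA k x t) s
    · intro i x s
      simp only [pA, Mod.h_cylu, R, hu]
      constructor
      · intro h1
        obtain ⟨a, ha⟩ := Lim.witness o
          (fun k t u => (M k).R u (t i) ∧ (M k).h x (update t i u))
          (fun k t u h => by
            refine ⟨(TR k _ _).1 h.1, ?_⟩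
            have := (hA k _ _).1 h.2
            rwa [← comp_assoc, comp_update] at this) s h1.frequently
        exact ⟨a, ha.mono fun _ h => h.1, ha.mono fun _ h => h.2⟩
      · rintro ⟨u, h1, h2⟩
        filter_upwards [h1, h2] with k h1 h2 using ⟨u.1 k, h1, h2⟩
    · intro i x s
      simp only [pA, Mod.h_cyld, R, hu]
      constructor
      · intro h1
        obtain ⟨a, ha⟩ := Lim.witness o
          (fun k t u => (M k).R (t i) u ∧ (M k).h x (update t i u))
          (fun k t u h => by
            refine ⟨(TR k _ _).1 h.1, ?_⟩
            have := (hA k _ _).1 h.2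
            rwa [← comp_assoc, comp_update] at this) s h1.frequently
        exact ⟨a, ha.mono fun _ h => h.1, ha.mono fun _ h => h.2⟩
      · rintro ⟨u, h1, h2⟩
        filter_upwards [h1, h2] with k h1 h2 using ⟨u.1 k, h1, h2⟩
    · intro i j s
      simp only [pA, Mod.h_diag, E]
  have rB : PreRep B (Lim X T) E R pB := by
    have wit : ∀ (Q : ∀ k, (N k).U → (N k).U → Prop) (Q' : ∀ k, (M k).U → (M k).U → Prop)
        (_ : ∀ k a b, Q' k a b → Q' (k + 1) (T k a) (T k b))
        (_ : ∀ k a b, Q k a b → Q' (k + 1) (d k a) (d k b))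
        (i : Fin n) (y : B.carrier) (s : Fin n → Lim X T)
        (_ : ∀ᶠ k in atTop, ∃ u, Q k u (e k ((s i).1 k)) ∧
          (N k).h y (update (e k ∘ fun j => (s j).1 k) i u)),
        ∃ a : Lim X T, ∀ᶠ k in atTop, Q' k (a.1 k) ((s i).1 k) ∧
          (N k).h y (e k ∘ update (fun j => (s j).1 k) i (a.1 k)) := by
      intro Q Q' h1 h2 i y s h
      refine Lim.witness o
        (fun k t u => Q' k u (t i) ∧ (N k).h y (e k ∘ update t i u)) ?_ s ?_
      · intro k t u h
        refine ⟨h1 _ _ _ h.1, ?_⟩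
        have := (hB k _ _).1 h.2
        have e1 : d k ∘ e k ∘ update t i u = update (T k ∘ t) i (T k u) := by
          rw [← comp_assoc, comp_update]
        rwa [e1] at this
      · have hs : ∀ᶠ k in atTop, ∀ j, (s j).1 (k + 1) = T k ((s j).1 k) :=
          eventually_all.2 fun j => (s j).2
        obtain ⟨K0, hK0⟩ := eventually_atTop.1 (hs.and h)
        refine frequently_atTop.2 fun K => ⟨max K K0 + 1, by omega, ?_⟩
        obtain ⟨h3, u, h4, h5⟩ := hK0 (max K K0) (by omega)
        generalize max K K0 = k at *
        refine ⟨d k u, ?_, ?_⟩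
        · have := h2 _ _ _ h4
          show Q' (k + 1) (d k u) ((s i).1 (k + 1))
          rw [h3]; exact this
        · have := (hB k _ _).1 h5
          rw [comp_update] at this
          have e1 : (fun j => (s j).1 (k + 1)) = d k ∘ e k ∘ fun j => (s j).1 k := funext h3
          rw [e1]; exact this
    refine ⟨?_, ?_, ?_, ?_, ?_, ?_⟩
    · intro x s s' hs h1
      have hs : ∀ᶠ i in atTop, ∀ j, (s j).1 i = (s' j).1 i := eventually_all.2 hs
      filter_upwards [hs, h1] with i h1 h2
      simpa only [h1] using h2
    · intro x y s
      simp only [pB, Mod.h_inf, eventually_and]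
    · intro x s
      simp only [pB, Mod.h_compl]
      exact Lim.not (fun k t => (N k).h x (e k ∘ t)) (fun k t => hB k x _) s
    · intro i y s
      simp only [pB, Mod.h_cylu, R, hu]
      constructor
      · intro h1
        obtain ⟨a, ha⟩ := wit (fun k a b => (N k).R a b) (fun k a b => (M k).R a b)
          (fun k a b => (TR k a b).1) (fun k a b => (dR k a b).1) i y s h1
        exact ⟨a, ha.mono fun _ h => h.1, ha.mono fun _ h => h.2⟩
      · rintro ⟨u, h1, h2⟩
        filter_upwards [h1, h2] with k h1 h2
        rw [comp_update] at h2
        exact ⟨e k (u.1 k), (eR k _ _).1 h1, h2⟩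
    · intro i y s
      simp only [pB, Mod.h_cyld, R, hu]
      constructor
      · intro h1
        obtain ⟨a, ha⟩ := wit (fun k a b => (N k).R b a) (fun k a b => (M k).R b a)
          (fun k a b => (TR k b a).1) (fun k a b => (dR k b a).1) i y s h1
        exact ⟨a, ha.mono fun _ h => h.1, ha.mono fun _ h => h.2⟩
      · rintro ⟨u, h1, h2⟩
        filter_upwards [h1, h2] with k h1 h2
        rw [comp_update] at h2
        exact ⟨e k (u.1 k), (eR k _ _).1 h1, h2⟩
    · intro i j s
      simp only [pB, Mod.h_diag, E, comp_apply, ← eE]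
  have hC : ∀ c s, pA (f c) s ↔ pB (g c) s := by
    intro c s
    simp only [pA, pB, heC]
  choose s hs hs' using fun j => lift_seq 0 X T o (s0 j)
  let s' : Fin n → Lim X T := fun j => ⟨s j, eventually_atTop.2 ⟨0, hs' j⟩⟩
  have hsk : ∀ k, T k ∘ (fun j => s j k) = fun j => s j (k + 1) := fun k =>
    funext fun j => (hs' j k (by omega)).symm
  refine ⟨(quotMod b rA).U, (quotMod b rA).R, fun x => {s | (quotMod b rA).h x s},
    fun y => {s | (quotMod b rB).h y s}, (quotMod b rA).pst, (quotMod b rA).ext,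
    (quotMod b rA).toHom, (quotMod b rB).toHom, fun c => ?_, fun j => quotMk b rA (s' j), ?_, ?_⟩
  · exact Set.ext fun t => hC c _
  · intro x hx
    refine (quotMk_h b rA x s').2 (Eventually.of_forall fun k => ?_)
    induction k with
    | zero => simpa only [s', hs] using hx
    | succ k ih =>
      have := (hA k _ _).1 ih
      rw [← comp_assoc] at this
      have h2 := hsk k
      simp only [T] at h2
      simp only [s', h2] at this
      exact this
  · intro y hy
    refine (quotMk_h b rB y s').2 (Eventually.of_forall fun k => ?_)
    induction k with
    | zero => simpa only [s', hs] using hy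
    | succ k ih =>
      have := (hB k _ _).1 ih
      rw [← comp_assoc (d k)] at this
      have h2 := hsk k
      simp only [T] at h2
      simp only [s', h2] at this
      exact this

end DCA
namespace DCA

open Function Filter

variable {n : ℕ} {A B C : DAlg n}

theorem step (hn : 3 ≤ n) {f : C.carrier → A.carrier} {g : C.carrier → B.carrier}
    (hf : DHom C A f) (hg : DHom C B g) (M : Mod A) (N : Mod B) (o : M.U) (e : M.U → N.U)
    (he : ∀ x s, M.h (f x) s ↔ N.h (g x) (e ∘ s)) :
    ∃ (M' : Mod A) (d : N.U → M'.U),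
      (∀ x s, N.h (g x) s ↔ M'.h (f x) (d ∘ s)) ∧
      (∀ x s, M.h x s ↔ M'.h x (d ∘ e ∘ s)) := by
  obtain ⟨M', d, h1, h2⟩ := extend hf M (N.red hg) (J := M.U) id e (fun Φ K hΦ =>
    local_step hn (M.red hf) (N.red hg) e he o Φ hΦ K)
  exact ⟨M', d, h1, h2⟩

theorem base (hn : 3 ≤ n) {f : C.carrier → A.carrier} {g : C.carrier → B.carrier}
    (hf : DHom C A f) (hg : DHom C B g) (M : Mod A) (N : Mod B)
    (s : Fin n → M.U) (t : Fin n → N.U)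
    (hst : ∀ x, M.h (f x) s ↔ N.h (g x) t) :
    ∃ (M' : Mod A) (d : N.U → M'.U),
      (∀ x s, N.h (g x) s ↔ M'.h (f x) (d ∘ s)) ∧
      (∀ x, M.h x s ↔ M'.h x (d ∘ t)) := by
  obtain ⟨M', d, h1, h2⟩ := extend hf M (N.red hg) (J := Fin n) s t (fun Φ K hΦ => by
    obtain ⟨v, h1, h2⟩ := local_base hn (M.red hf) (N.red hg) s t hst Φ hΦ
    exact ⟨v, fun j _ => h1 j, h2⟩)
  exact ⟨M', d, h1, fun x => h2 x id⟩

structure St (f : C.carrier → A.carrier) (g : C.carrier → B.carrier) where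
  M : Mod A
  N : Mod B
  o : M.U
  e : M.U → N.U
  he : ∀ x s, M.h (f x) s ↔ N.h (g x) (e ∘ s)

theorem St.next (hn : 3 ≤ n) {f : C.carrier → A.carrier} {g : C.carrier → B.carrier}
    (hf : DHom C A f) (hg : DHom C B g) (S : St f g) :
    ∃ (S' : St f g) (d : S.N.U → S'.M.U),
      (∀ x s, S.N.h (g x) s ↔ S'.M.h (f x) (d ∘ s)) ∧
      (∀ x s, S.M.h x s ↔ S'.M.h x (d ∘ S.e ∘ s)) ∧
      (∀ x s, S.N.h x s ↔ S'.N.h x (S'.e ∘ d ∘ s)) := by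
  obtain ⟨M', d, h1, h2⟩ := step hn hf hg S.M S.N S.o S.e S.he
  obtain ⟨N', e', h3, h4⟩ := step hn hg hf S.N M' (S.e S.o) d h1
  exact ⟨⟨M', N', d (S.e S.o), e', h3⟩, d, h1, h2, h4⟩

theorem joint (hn : 3 ≤ n) {f : C.carrier → A.carrier} {g : C.carrier → B.carrier}
    (hf : DHom C A f) (hg : DHom C B g) (M : Mod A) (N : Mod B)
    (s : Fin n → M.U) (t : Fin n → N.U)
    (hst : ∀ x, M.h (f x) s ↔ N.h (g x) t) :
    ∃ (U : Type) (R : U → U → Prop) (p : A.carrier → Set (Fin n → U))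
      (q : B.carrier → Set (Fin n → U)), IsPStruct U R ∧ IsExtensional U R ∧
      DHom A (fullDAlg n U R) p ∧ DHom B (fullDAlg n U R) q ∧ (∀ c, p (f c) = q (g c)) ∧
      ∃ s' : Fin n → U, (∀ x, M.h x s → s' ∈ p x) ∧ (∀ y, N.h y t → s' ∈ q y) := by
  obtain ⟨N0, e0, h1, h2⟩ := base hn hg hf N M t s (fun x => (hst x).symm)
  let S0 : St f g := ⟨M, N0, s ⟨0, by omega⟩, e0, h1⟩
  choose nx d hd1 hd2 hd3 using St.next hn hf hg
  let S : ℕ → St f g := fun k => Nat.rec S0 (fun _ T => nx T) k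
  obtain ⟨U, R, p, q, h3, h4, h5, h6, h7, s', h8, h9⟩ := limit hn hf hg (fun k => (S k).M)
    (fun k => (S k).N) (fun k => (S k).e) (fun k => d (S k)) (fun k => (S k).he)
    (fun k => hd1 (S k)) (fun k => hd2 (S k)) (fun k => hd3 (S k)) s
  exact ⟨U, R, p, q, h3, h4, h5, h6, h7, s', h8, fun y hy => h9 y ((h2 y).1 hy)⟩

theorem mod_of_hom {U : Type} {R : U → U → Prop} (hP : IsPStruct U R) (hE : IsExtensional U R)
    {p : A.carrier → Set (Fin n → U)} (hp : DHom A (fullDAlg n U R) p) :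
    ∃ M : Mod A, ∃ hU : M.U = U, ∀ x (s : Fin n → U), M.h x (fun j => cast hU.symm (s j)) ↔
      s ∈ p x := by
  have key : ∀ (i : Fin n) (s z : Fin n → U), (∀ j, j ≠ i → s j = z j) → z = update s i (z i) := by
    intro i s z h
    funext j
    by_cases hj : j = i
    · subst hj; simp
    · simp [update_of_ne hj, h j hj]
  refine ⟨⟨U, R, fun x s => s ∈ p x, hP, hE, ?_, ?_, ?_, ?_, ?_⟩, rfl, ?_⟩
  rotate_right
  · intro x s; simp only [cast_eq]
  · intro x y s; rw [hp.1]; rfl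
  · intro x s; rw [hp.2.1]; rfl
  · intro i x s; rw [hp.2.2.1]
    constructor
    · rintro ⟨z, h1, h2, h3⟩
      exact ⟨z i, h2, by rw [← key i s z h3]; exact h1⟩
    · rintro ⟨u, h1, h2⟩
      exact ⟨update s i u, h2, by simpa using h1, fun j hj => by simp [update_of_ne hj]⟩
  · intro i x s; rw [hp.2.2.2.1]
    constructor
    · rintro ⟨z, h1, h2, h3⟩
      exact ⟨z i, h2, by rw [← key i s z h3]; exact h1⟩
    · rintro ⟨u, h1, h2⟩
      exact ⟨update s i u, h2, by simpa using h1, fun j hj => by simp [update_of_ne hj]⟩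
  · intro i j s; rw [hp.2.2.2.2]; rfl

theorem DHom.comp' {D : DAlg n} {f : A.carrier → B.carrier} {g : B.carrier → D.carrier}
    (hf : DHom A B f) (hg : DHom B D g) : DHom A D (fun x => g (f x)) := by
  refine ⟨fun x y => ?_, fun x => ?_, fun i x => ?_, fun i x => ?_, fun i j => ?_⟩
  · show g (f _) = _
    rw [hf.1, hg.1]
  · show g (f _) = _
    rw [hf.2.1, hg.2.1]
  · show g (f _) = _
    rw [hf.2.2.1, hg.2.2.1]
  · show g (f _) = _
    rw [hf.2.2.2.1, hg.2.2.2.1]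
  · show g (f _) = _
    rw [hf.2.2.2.2, hg.2.2.2.2]

theorem eq_of (hA : A ∈ RCAup n) {x y : A.carrier}
    (hcon : ∀ (M : Mod A) (s : Fin n → M.U), M.h x s ↔ M.h y s) : x = y := by
  by_contra h
  obtain ⟨ι, D, hD, p, hpi, hp⟩ := hA
  have h1 : p x ≠ p y := fun h' => h (hpi h')
  obtain ⟨i, hi⟩ := Function.ne_iff.1 h1
  obtain ⟨U, R, hP, hE, q, hqi, hq⟩ := hD i
  have hpr : DHom A (D i) (fun x => p x i) :=
    ⟨fun x y => congrFun (hp.1 x y) i, fun x => congrFun (hp.2.1 x) i,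
      fun k x => congrFun (hp.2.2.1 k x) i, fun k x => congrFun (hp.2.2.2.1 k x) i,
      fun k l => congrFun (hp.2.2.2.2 k l) i⟩
  obtain ⟨M, hU, hM⟩ := mod_of_hom hP hE (DHom.comp' hpr hq)
  refine hi (hqi ?_)
  refine Set.ext (α := Fin n → U) fun s => ?_
  exact (hM _ s).symm.trans (Iff.trans (hcon M _) (hM _ s))

theorem sep (hA : A ∈ RCAup n) {x y : A.carrier} (h : A.str.inf x y ≠ x) :
    ∃ (M : Mod A) (s : Fin n → M.U), M.h x s ∧ ¬ M.h y s := by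
  by_contra! hcon
  refine h (eq_of hA fun M s => ?_)
  rw [M.h_inf]
  exact ⟨fun h => h.1, fun h => ⟨h, hcon M _ h⟩⟩

theorem dle_h {x y : A.carrier} (h : dLe A x y) (M : Mod A) (s) (hx : M.h x s) : M.h y s := by
  have h : A.str.inf x y = x := h
  rw [← h, M.h_inf] at hx
  exact hx.2

theorem dle_of (hA : A ∈ RCAup n) {x y : A.carrier} (h : ∀ (M : Mod A) s, M.h x s → M.h y s) :
    dLe A x y := by
  by_contra hne
  obtain ⟨M, s, h1, h2⟩ := sep hA hne
  exact h2 (h M s h1)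

theorem points (hn : 3 ≤ n) {f : C.carrier → A.carrier} {g : C.carrier → B.carrier}
    (hf : DHom C A f) (hg : DHom C B g) (hA : A ∈ RCAup n) (hB : B ∈ RCAup n)
    (a : A.carrier) (b : B.carrier) (hab : ¬ ∃ t, dLe A a (f t) ∧ dLe B (g t) b) :
    ∃ (M : Mod A) (N : Mod B) (s : Fin n → M.U) (t : Fin n → N.U),
      (∀ x, M.h (f x) s ↔ N.h (g x) t) ∧ M.h a s ∧ N.h (B.str.compl b) t := by
  have htr : Nonempty {x : C.carrier // dLe A a (f x)} :=
    ⟨⟨C.str.diag ⟨0, by omega⟩ ⟨0, by omega⟩,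
      dle_of hA fun M s _ => by rw [hf.2.2.2.2, M.h_diag]⟩⟩
  obtain ⟨N, t, hN⟩ := compactness (A := B) (ι := {x : C.carrier // dLe A a (f x)})
    (fun x => B.str.inf (g x.1) (B.str.compl b)) (by
      rintro ⟨x, hx⟩ ⟨y, hy⟩
      refine ⟨⟨C.str.inf x y, dle_of hA fun M s h => ?_⟩, fun M s h => ?_⟩
      · rw [hf.1, M.h_inf]; exact ⟨dle_h hx M s h, dle_h hy M s h⟩
      · simp only [hg.1, M.h_inf] at h ⊢
        tauto) (by
      rintro ⟨x, hx⟩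
      obtain ⟨M, s, h1, h2⟩ := sep hB (fun h => hab ⟨x, hx, h⟩)
      exact ⟨M, s, by rw [M.h_inf, M.h_compl]; exact ⟨h1, h2⟩⟩)
  simp only [N.h_inf, Subtype.forall] at hN
  obtain ⟨⟨x0, hx0⟩⟩ := htr
  haveI : Nonempty {x : C.carrier // N.h (g x) t} := ⟨⟨x0, (hN x0 hx0).1⟩⟩
  obtain ⟨M, s, hM⟩ := compactness (A := A) (ι := {x : C.carrier // N.h (g x) t})
    (fun x => A.str.inf (f x.1) a) (by
      rintro ⟨x, hx⟩ ⟨y, hy⟩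
      refine ⟨⟨C.str.inf x y, ?_⟩, fun M s h => ?_⟩
      · rw [hg.1, N.h_inf]; exact ⟨hx, hy⟩
      · simp only [hf.1, M.h_inf] at h ⊢
        tauto) (by
      rintro ⟨x, hx⟩
      by_contra! hcon
      have h1 : dLe A a (f (C.str.compl x)) := dle_of hA fun M s h => by
        have := hcon M s
        rw [M.h_inf] at this
        rw [hf.2.1, M.h_compl]
        tauto
      have := (hN _ h1).1
      rw [hg.2.1, N.h_compl] at this
      exact this hx)
  simp only [M.h_inf, Subtype.forall] at hM
  refine ⟨M, N, s, t, fun x => ⟨fun h => ?_, fun h => (hM x h).1⟩,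
    (hM x0 (hN x0 hx0).1).2, (hN x0 hx0).2⟩
  by_contra hx
  have := (hM (C.str.compl x) (by rw [hg.2.1, N.h_compl]; exact hx)).1
  rw [hf.2.1, M.h_compl] at this
  exact this h

end DCA

/-- The class `CA↑` of directed cylindric algebras has the
superamalgamation property: for all `A, B, C ∈ CA↑_n` (`n ≥ 3`) and monomorphisms
`f : C → A`, `g : C → B` there are `D ∈ CA↑_n` and monomorphisms `m : A → D`, `n' : B → D`
with `m ∘ f = n' ∘ g`, and whenever `m a ≤ n' b` there is `t ∈ C` with `a ≤ f t` and
`g t ≤ b` (where `≤` is the Boolean partial order). -/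
theorem directed_CA_superamalgamation (n : ℕ) (hn : 3 ≤ n)
    (A B C : DAlg n) (hA : A ∈ RCAup n) (hB : B ∈ RCAup n) (hC : C ∈ RCAup n)
    (f : C.carrier → A.carrier) (g : C.carrier → B.carrier)
    (hf : DHom C A f) (hfi : Function.Injective f)
    (hg : DHom C B g) (hgi : Function.Injective g) :
    ∃ D : DAlg n, D ∈ RCAup n ∧
      ∃ (m : A.carrier → D.carrier) (n' : B.carrier → D.carrier),
        DHom A D m ∧ Function.Injective m ∧ DHom B D n' ∧ Function.Injective n' ∧
        (∀ c : C.carrier, m (f c) = n' (g c)) ∧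
        (∀ (a : A.carrier) (b : B.carrier),
          dLe D (m a) (n' b) → ∃ t : C.carrier, dLe A a (f t) ∧ dLe B (g t) b) := by
  classical
  let i0 : Fin n := ⟨0, by omega⟩
  let ι : Type := {ab : A.carrier × B.carrier // ¬ ∃ t, dLe A ab.1 (f t) ∧ dLe B (g t) ab.2}
  have key : ∀ i : ι, ∃ (U : Type) (R : U → U → Prop) (p : A.carrier → Set (Fin n → U))
      (q : B.carrier → Set (Fin n → U)), IsPStruct U R ∧ IsExtensional U R ∧
      DHom A (fullDAlg n U R) p ∧ DHom B (fullDAlg n U R) q ∧ (∀ c, p (f c) = q (g c)) ∧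
      ∃ s' : Fin n → U, s' ∈ p i.1.1 ∧ s' ∉ q i.1.2 := by
    rintro ⟨⟨a, b⟩, hab⟩
    obtain ⟨M, N, s, t, h1, h2, h3⟩ := DCA.points hn hf hg hA hB a b hab
    obtain ⟨U, R, p, q, k1, k2, k3, k4, k5, s', k6, k7⟩ := DCA.joint hn hf hg M N s t h1
    refine ⟨U, R, p, q, k1, k2, k3, k4, k5, s', k6 _ h2, ?_⟩
    have := k7 _ h3
    rw [k4.2.1] at this
    exact this
  choose U R p q hP hE hp hq hpq s' hs1 hs2 using key
  let D : DAlg n := prodDAlg (fun i : ι => fullDAlg n (U i) (R i))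
  let m : A.carrier → D.carrier := fun a i => p i a
  let n' : B.carrier → D.carrier := fun b i => q i b
  have hm : DHom A D m :=
    ⟨fun x y => funext fun i => (hp i).1 x y, fun x => funext fun i => (hp i).2.1 x,
      fun k x => funext fun i => (hp i).2.2.1 k x, fun k x => funext fun i => (hp i).2.2.2.1 k x,
      fun k l => funext fun i => (hp i).2.2.2.2 k l⟩
  have hn' : DHom B D n' :=
    ⟨fun x y => funext fun i => (hq i).1 x y, fun x => funext fun i => (hq i).2.1 x,
      fun k x => funext fun i => (hq i).2.2.1 k x, fun k x => funext fun i => (hq i).2.2.2.1 k x,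
      fun k l => funext fun i => (hq i).2.2.2.2 k l⟩
  have hsup : ∀ (a : A.carrier) (b : B.carrier),
      dLe D (m a) (n' b) → ∃ t : C.carrier, dLe A a (f t) ∧ dLe B (g t) b := by
    intro a b h
    by_contra hab
    have h1 : (p ⟨(a, b), hab⟩ a ∩ q ⟨(a, b), hab⟩ b : Set _) = p ⟨(a, b), hab⟩ a :=
      congrFun h (⟨(a, b), hab⟩ : ι)
    have h2 := hs1 ⟨(a, b), hab⟩
    have h3 : s' ⟨(a, b), hab⟩ ∈ (p ⟨(a, b), hab⟩ a ∩ q ⟨(a, b), hab⟩ b : Set _) := by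
      rw [h1]; exact h2
    exact hs2 ⟨(a, b), hab⟩ h3.2
  have hmle : ∀ x y, m x = m y → ∀ (M : DCA.Mod A) s, M.h x s → M.h y s := by
    intro x y hxy M s hx
    obtain ⟨t, h1, h2⟩ := hsup (A.str.inf x (A.str.compl y)) (g (C.str.compl (C.str.diag i0 i0)))
      (funext fun i => by
        have e : p i x = p i y := congrFun hxy i
        have e2 : m (A.str.inf x (A.str.compl y)) i = (∅ : Set (Fin n → U i)) := by
          show p i _ = _
          rw [(hp i).1, (hp i).2.1, e]
          exact Set.inter_compl_self _
        show (m (A.str.inf x (A.str.compl y)) i ∩ _ : Set (Fin n → U i)) = _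
        rw [e2]
        exact Set.empty_inter _)
    have h3 : g t = g (C.str.compl (C.str.diag i0 i0)) := DCA.eq_of hB fun N u => by
      refine ⟨fun h => DCA.dle_h h2 N u h, fun h => ?_⟩
      rw [hg.2.1, hg.2.2.2.2, N.h_compl, N.h_diag] at h
      exact absurd rfl h
    by_contra hy
    have h4 := DCA.dle_h h1 M s (by rw [M.h_inf, M.h_compl]; exact ⟨hx, hy⟩)
    rw [hgi h3, hf.2.1, hf.2.2.2.2, M.h_compl, M.h_diag] at h4
    exact h4 rfl
  have hnle : ∀ x y, n' x = n' y → ∀ (M : DCA.Mod B) s, M.h x s → M.h y s := by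
    intro x y hxy M s hx
    obtain ⟨t, h1, h2⟩ := hsup (f (C.str.diag i0 i0)) (B.str.compl (B.str.inf x (B.str.compl y)))
      (funext fun i => by
        have e : q i x = q i y := congrFun hxy i
        have e2 : n' (B.str.compl (B.str.inf x (B.str.compl y))) i
            = (Set.univ : Set (Fin n → U i)) := by
          show q i _ = _
          rw [(hq i).2.1, (hq i).1, (hq i).2.1, e]
          show (q i y ∩ (q i y)ᶜ)ᶜ = Set.univ
          rw [Set.inter_compl_self, Set.compl_empty]
        show (_ ∩ n' (B.str.compl (B.str.inf x (B.str.compl y))) i : Set (Fin n → U i)) = _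
        rw [e2]
        exact Set.inter_univ _)
    have h3 : f t = f (C.str.diag i0 i0) := DCA.eq_of hA fun N u => by
      refine ⟨fun h => ?_, fun h => DCA.dle_h h1 N u h⟩
      rw [hf.2.2.2.2, N.h_diag]
    by_contra hy
    have h4 := DCA.dle_h h2 M s (by rw [hfi h3, hg.2.2.2.2, M.h_diag])
    rw [M.h_compl, M.h_inf, M.h_compl] at h4
    exact h4 ⟨hx, hy⟩
  refine ⟨D, ⟨ι, fun i => fullDAlg n (U i) (R i), fun i => ⟨U i, R i, hP i, hE i, id,
      Function.injective_id, ⟨fun _ _ => rfl, fun _ => rfl, fun _ _ => rfl, fun _ _ => rfl,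
        fun _ _ => rfl⟩⟩, id, Function.injective_id, ⟨fun _ _ => rfl, fun _ => rfl,
        fun _ _ => rfl, fun _ _ => rfl, fun _ _ => rfl⟩⟩, m, n', hm, ?_, hn', ?_,
        fun c => funext fun i => hpq i c, hsup⟩
  · intro x y hxy
    exact DCA.eq_of hA fun M s => ⟨hmle x y hxy M s, hmle y x hxy.symm M s⟩
  · intro x y hxy
    exact DCA.eq_of hB fun M s => ⟨hnle x y hxy M s, hnle y x hxy.symm M s⟩
end

section
/- (Maddux) For each finite n ≥ 3, the equational theory of the variety Df_n of diagonal-free cylindric algebras of dimension n and the equational theory of the variety CA_n of cylindric algebras of dimension n are undecidable. -/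
/-- A cylindric algebra of dimension `m ≤ ω` (`m : ℕ∞`, with `m = ⊤` for dimension `ω`):
a Boolean algebra with cylindrifications `c i` and diagonals `d i j` for `i, j < m`,
satisfying the Henkin–Monk–Tarski axioms. -/
structure CAlg (m : ℕ∞) where
  carrier : Type
  [ba : BooleanAlgebra carrier]
  c : ℕ → carrier → carrier
  d : ℕ → ℕ → carrier
  c_bot : ∀ i : ℕ, (i : ℕ∞) < m → c i ⊥ = ⊥
  le_c : ∀ i : ℕ, (i : ℕ∞) < m → ∀ x, x ≤ c i x
  c_inf_c : ∀ i : ℕ, (i : ℕ∞) < m → ∀ x y, c i (x ⊓ c i y) = c i x ⊓ c i y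
  c_c : ∀ i j : ℕ, (i : ℕ∞) < m → (j : ℕ∞) < m → ∀ x, c i (c j x) = c j (c i x)
  d_refl : ∀ i : ℕ, (i : ℕ∞) < m → d i i = ⊤
  d_exp : ∀ i j k : ℕ, (i : ℕ∞) < m → (j : ℕ∞) < m → (k : ℕ∞) < m → i ≠ j → i ≠ k →
      d j k = c i (d j i ⊓ d i k)
  d_disj : ∀ i j : ℕ, (i : ℕ∞) < m → (j : ℕ∞) < m → i ≠ j → ∀ x,
      c i (d i j ⊓ x) ⊓ c i (d i j ⊓ xᶜ) = ⊥

attribute [instance] CAlg.ba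

namespace CAlg

/-- A homomorphism of `m`-dimensional cylindric algebras. -/
def Hom {m : ℕ∞} (A B : CAlg m) (f : A.carrier → B.carrier) : Prop :=
  (∀ x y, f (x ⊔ y) = f x ⊔ f y) ∧ (∀ x, f xᶜ = (f x)ᶜ) ∧
  (∀ i : ℕ, (i : ℕ∞) < m → ∀ x, f (A.c i x) = B.c i (f x)) ∧
  (∀ i j : ℕ, (i : ℕ∞) < m → (j : ℕ∞) < m → f (A.d i j) = B.d i j)

/-- The universe of the neat `n`-reduct `Nr_n M` of an `m`-dimensional cylindric algebra:
the elements fixed by all cylindrifications `cᵢ` with `n ≤ i < m`. -/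
def NrSet (n : ℕ) {m : ℕ∞} (M : CAlg m) : Set M.carrier :=
  {x | ∀ i : ℕ, n ≤ i → (i : ℕ∞) < m → M.c i x = x}

/-- The dimension set `Δx = {i : cᵢ x ≠ x}` of an element. -/
def dimSet {m : ℕ∞} (A : CAlg m) (x : A.carrier) : Set ℕ := {i | A.c i x ≠ x}

/-- The subuniverse of a cylindric algebra generated by a set `X`. -/
inductive Gen {m : ℕ∞} (A : CAlg m) (X : Set A.carrier) : A.carrier → Prop
  | gen {x} : x ∈ X → Gen A X x
  | top : Gen A X ⊤
  | sup {x y} : Gen A X x → Gen A X y → Gen A X (x ⊔ y)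
  | compl {x} : Gen A X x → Gen A X xᶜ
  | cylP {i : ℕ} {x} : (i : ℕ∞) < m → Gen A X x → Gen A X (A.c i x)
  | diagP {i j : ℕ} : (i : ℕ∞) < m → (j : ℕ∞) < m → Gen A X (A.d i j)

end CAlg

/-- `A ∈ S Nr_n CA_m`: the `n`-dimensional cylindric algebra `A` embeds into the neat
`n`-reduct of some `m`-dimensional cylindric algebra. -/
def InSNr (n : ℕ) (m : ℕ∞) (A : CAlg (n : ℕ∞)) : Prop :=
  ∃ (M : CAlg m) (f : A.carrier → M.carrier),
    Function.Injective f ∧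
    (∀ x, f x ∈ CAlg.NrSet n M) ∧
    (∀ x y, f (x ⊔ y) = f x ⊔ f y) ∧
    (∀ x, f xᶜ = (f x)ᶜ) ∧
    (∀ i : ℕ, i < n → ∀ x, f (A.c i x) = M.c i (f x)) ∧
    (∀ i j : ℕ, i < n → j < n → f (A.d i j) = M.d i j)

/-- `Fr_β^ρ K`, the dimension-restricted free algebra of the class `K` on `β` generators
`g i` with dimension restriction `Δ(g i) ⊆ ρ i`, characterized by its universal property:
it lies in `K`, is generated by its generators (which satisfy the dimension restriction),
and every `ρ`-admissible assignment of the generators into a member of `K` extends to a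
homomorphism. -/
def IsDimRestrictedFree {μ : ℕ∞} (K : Set (CAlg μ)) (β : ℕ) (ρ : Fin β → Set ℕ)
    (F : CAlg μ) (g : Fin β → F.carrier) : Prop :=
  F ∈ K ∧
  (∀ i : Fin β, CAlg.dimSet F (g i) ⊆ ρ i) ∧
  (∀ x : F.carrier, CAlg.Gen F (Set.range g) x) ∧
  (∀ A ∈ K, ∀ a : Fin β → A.carrier, (∀ i, CAlg.dimSet A (a i) ⊆ ρ i) →
    ∃ f : F.carrier → A.carrier, CAlg.Hom F A f ∧ ∀ i, f (g i) = a i)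

/-- `A` is a representable cylindric algebra of dimension `4`: it embeds into a product of
full cylindric set algebras of dimension `4`. -/
def InRCA4 (A : CAlg (4 : ℕ∞)) : Prop :=
  ∃ (ι : Type) (U : ι → Type) (f : A.carrier → ∀ i : ι, Set (Fin 4 → U i)),
    Function.Injective f ∧
    (∀ x y, f (x ⊔ y) = fun i => f x i ∪ f y i) ∧
    (∀ x, f xᶜ = fun i => (f x i)ᶜ) ∧
    (∀ k : ℕ, k < 4 → ∀ x, f (A.c k x) =
      fun i => {s | ∃ z ∈ f x i, ∀ j : Fin 4, (j : ℕ) ≠ k → s j = z j}) ∧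
    (∀ (k l : ℕ) (hk : k < 4) (hl : l < 4),
      f (A.d k l) = fun i => {s | s ⟨k, hk⟩ = s ⟨l, hl⟩})

/-- A diagonal-free cylindric algebra of dimension `n`: a Boolean algebra with
cylindrifications `c i` (`i < n`) satisfying the diagonal-free Henkin–Monk–Tarski
axioms. -/
structure DfAlg (n : ℕ) where
  carrier : Type
  [ba : BooleanAlgebra carrier]
  c : ℕ → carrier → carrier
  c_bot : ∀ i : ℕ, i < n → c i ⊥ = ⊥
  le_c : ∀ i : ℕ, i < n → ∀ x, x ≤ c i x
  c_inf_c : ∀ i : ℕ, i < n → ∀ x y, c i (x ⊓ c i y) = c i x ⊓ c i y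
  c_c : ∀ i j : ℕ, i < n → j < n → ∀ x, c i (c j x) = c j (c i x)

attribute [instance] DfAlg.ba

/-- Terms in the similarity type of `CA_n`. -/
inductive CTerm (n : ℕ) : Type
  | var : ℕ → CTerm n
  | bot : CTerm n
  | top : CTerm n
  | sup : CTerm n → CTerm n → CTerm n
  | inf : CTerm n → CTerm n → CTerm n
  | compl : CTerm n → CTerm n
  | cyl : Fin n → CTerm n → CTerm n
  | diag : Fin n → Fin n → CTerm n

/-- Terms in the similarity type of `Df_n`. -/
inductive DfTerm (n : ℕ) : Type
  | var : ℕ → DfTerm n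
  | bot : DfTerm n
  | top : DfTerm n
  | sup : DfTerm n → DfTerm n → DfTerm n
  | inf : DfTerm n → DfTerm n → DfTerm n
  | compl : DfTerm n → DfTerm n
  | cyl : Fin n → DfTerm n → DfTerm n

def CTerm.eval {n : ℕ} (A : CAlg (n : ℕ∞)) (v : ℕ → A.carrier) : CTerm n → A.carrier
  | var i => v i
  | bot => ⊥
  | top => ⊤
  | sup s t => s.eval A v ⊔ t.eval A v
  | inf s t => s.eval A v ⊓ t.eval A v
  | compl t => (t.eval A v)ᶜ
  | cyl i t => A.c i (t.eval A v)
  | diag i j => A.d i j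

def DfTerm.eval {n : ℕ} (A : DfAlg n) (v : ℕ → A.carrier) : DfTerm n → A.carrier
  | var i => v i
  | bot => ⊥
  | top => ⊤
  | sup s t => s.eval A v ⊔ t.eval A v
  | inf s t => s.eval A v ⊓ t.eval A v
  | compl t => (t.eval A v)ᶜ
  | cyl i t => A.c i (t.eval A v)

/-- An equation `s = t` belongs to the equational theory of the variety `CA_n`. -/
def CAEqValid (n : ℕ) (s t : CTerm n) : Prop :=
  ∀ (A : CAlg (n : ℕ∞)) (v : ℕ → A.carrier), s.eval A v = t.eval A v

/-- An equation `s = t` belongs to the equational theory of the variety `Df_n`. -/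
def DfEqValid (n : ℕ) (s t : DfTerm n) : Prop :=
  ∀ (A : DfAlg n) (v : ℕ → A.carrier), s.eval A v = t.eval A v

/-- A Gödel numbering of `CA_n`-terms. -/
def CTerm.code {n : ℕ} : CTerm n → ℕ
  | var i => Nat.pair 0 i
  | bot => Nat.pair 1 0
  | top => Nat.pair 2 0
  | sup s t => Nat.pair 3 (Nat.pair s.code t.code)
  | inf s t => Nat.pair 4 (Nat.pair s.code t.code)
  | compl t => Nat.pair 5 t.code
  | cyl i t => Nat.pair 6 (Nat.pair i.1 t.code)
  | diag i j => Nat.pair 7 (Nat.pair i.1 j.1)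

/-- A Gödel numbering of `Df_n`-terms. -/
def DfTerm.code {n : ℕ} : DfTerm n → ℕ
  | var i => Nat.pair 0 i
  | bot => Nat.pair 1 0
  | top => Nat.pair 2 0
  | sup s t => Nat.pair 3 (Nat.pair s.code t.code)
  | inf s t => Nat.pair 4 (Nat.pair s.code t.code)
  | compl t => Nat.pair 5 t.code
  | cyl i t => Nat.pair 6 (Nat.pair i.1 t.code)

section MadduxAbstract
open Turing

variable {B : Type} [BooleanAlgebra B] {K G Λ σ : Type} [DecidableEq K]

/-- stack contents after the pushes listed in `w` (head = last push) -/
def mxStk : List (K × G) → K → List G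
  | [] => fun _ => []
  | p :: w => Function.update (mxStk w) p.1 (p.2 :: mxStk w p.1)

def mxX (c : ℕ → B → B) (E : ℕ → B) (a : K → G → ℕ → B) : List (K × G) → B
  | [] => E 0
  | p :: w => c w.length (mxX c E a w ⊓ a p.1 p.2 w.length)

structure MxCyl (c : ℕ → B → B) : Prop where
  bot : ∀ l, c l ⊥ = ⊥
  le : ∀ l x, x ≤ c l x
  inf : ∀ l x y, c l (x ⊓ c l y) = c l x ⊓ c l y
  comm : ∀ l m x, c l (c m x) = c m (c l x)
  per : ∀ l x, c (l + 3) x = c l x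

theorem MxCyl.idem {c : ℕ → B → B} (h : MxCyl c) (l x) : c l (c l x) = c l x := by
  have h1 := h.inf l ⊤ x
  have h2 : c l ⊤ = ⊤ := top_le_iff.1 (h.le l ⊤)
  simpa [h2] using h1

theorem MxCyl.mono {c : ℕ → B → B} (h : MxCyl c) (l) {x y} (hxy : x ≤ y) : c l x ≤ c l y := by
  have h1 := h.inf l x y
  rw [inf_eq_left.2 (hxy.trans (h.le l y))] at h1
  rw [h1]; exact inf_le_right

theorem MxCyl.infc {c : ℕ → B → B} (h : MxCyl c) (l) {x y} (hy : c l y = y) :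
    c l (x ⊓ y) = c l x ⊓ y := by
  have := h.inf l x y
  rwa [hy] at this

theorem MxCyl.infc' {c : ℕ → B → B} (h : MxCyl c) (l) {x y} (hy : c l y = y) :
    c l (y ⊓ x) = y ⊓ c l x := by
  rw [inf_comm, h.infc l hy, inf_comm]

theorem MxCyl.compl {c : ℕ → B → B} (h : MxCyl c) (l) {y} (hy : c l y = y) :
    c l yᶜ = yᶜ := by
  apply le_antisymm _ (h.le l _)
  rw [le_compl_iff_disjoint_right, disjoint_iff, ← h.infc l hy]
  simp [h.bot]

structure MxSim (c : ℕ → B → B) (M : Λ → TM2.Stmt (fun _ : K => G) Λ σ)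
    (T : Set (TM2.Stmt (fun _ : K => G) Λ σ))
    (R : TM2.Stmt (fun _ : K => G) Λ σ → σ → ℕ → B) (Z : K → ℕ → B) (E : ℕ → B)
    (a : K → G → ℕ → B) (z : B) : Prop extends MxCyl c where
  zc : ∀ l, c l z = z
  R1 : ∀ q v l, c (l+1) (R q v l) = R q v l
  R2 : ∀ q v l, c (l+2) (R q v l) = R q v l
  Z2 : ∀ k l, c (l+2) (Z k l) = Z k l
  E1 : ∀ l, c (l+1) (E l) = E l
  E2 : ∀ l, c (l+2) (E l) = E l
  a2 : ∀ k g l, c (l+2) (a k g l) = a k g l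
  ser : ∀ k g l, z ≤ c (l+1) (a k g l)
  zp : ∀ k k' g l, k ≠ k' → Z k' l ⊓ a k g l ⊓ z ≤ Z k' (l+1)
  e0 : ∀ k l, E l ⊓ z ≤ Z k l
  com : ∀ k g k' g' l, k ≠ k' → c (l+1) (a k g l ⊓ a k' g' (l+1)) ⊓ z ≤
      c (l+1) (a k' g' l ⊓ a k g (l+1))
  push : ∀ k f q v l, TM2.Stmt.push k f q ∈ T →
    R (.push k f q) v l ⊓ a k (f v) l ⊓ z ≤ R q v (l+1)
  pop : ∀ k f q v g l, TM2.Stmt.pop k f q ∈ T →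
    R (.pop k f q) v (l+1) ⊓ a k g l ⊓ z ≤ R q (f v (some g)) l
  pop0 : ∀ k f q v l, TM2.Stmt.pop k f q ∈ T →
    R (.pop k f q) v l ⊓ Z k l ⊓ z ≤ R q (f v none) l
  peek : ∀ k f q v g l, TM2.Stmt.peek k f q ∈ T →
    R (.peek k f q) v (l+1) ⊓ a k g l ⊓ z ≤ R q (f v (some g)) (l+1)
  peek0 : ∀ k f q v l, TM2.Stmt.peek k f q ∈ T →
    R (.peek k f q) v l ⊓ Z k l ⊓ z ≤ R q (f v none) l
  load : ∀ f q v l, TM2.Stmt.load f q ∈ T →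
    R (.load f q) v l ⊓ z ≤ R q (f v) l
  branch : ∀ f q q' v l, TM2.Stmt.branch f q q' ∈ T →
    R (.branch f q q') v l ⊓ z ≤ R (cond (f v) q q') v l
  goto : ∀ f v l, TM2.Stmt.goto f ∈ T →
    R (.goto f) v l ⊓ z ≤ R (M (f v)) v l
  halt : ∀ v l, TM2.Stmt.halt ∈ T → R .halt v l ⊓ z = ⊥

structure MxClosed (M : Λ → TM2.Stmt (fun _ : K => G) Λ σ)
    (T : Set (TM2.Stmt (fun _ : K => G) Λ σ)) : Prop where
  push : ∀ k f q, TM2.Stmt.push k f q ∈ T → q ∈ T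
  pop : ∀ k f q, TM2.Stmt.pop k f q ∈ T → q ∈ T
  peek : ∀ k f q, TM2.Stmt.peek k f q ∈ T → q ∈ T
  load : ∀ f q, TM2.Stmt.load f q ∈ T → q ∈ T
  branch : ∀ f q q', TM2.Stmt.branch f q q' ∈ T → q ∈ T ∧ q' ∈ T
  goto : ∀ f, TM2.Stmt.goto f ∈ T → ∀ v, M (f v) ∈ T

section
variable {c : ℕ → B → B} {M : Λ → TM2.Stmt (fun _ : K => G) Λ σ}
    {T : Set (TM2.Stmt (fun _ : K => G) Λ σ)}
    {R : TM2.Stmt (fun _ : K => G) Λ σ → σ → ℕ → B} {Z : K → ℕ → B} {E : ℕ → B}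
    {a : K → G → ℕ → B} {z : B}

theorem MxSim.x_closed (h : MxSim c M T R Z E a z) (w : List (K × G)) :
    c (w.length + 1) (mxX c E a w) = mxX c E a w ∧
    c (w.length + 2) (mxX c E a w) = mxX c E a w := by
  induction w with
  | nil => exact ⟨h.E1 0, h.E2 0⟩
  | cons p w ih =>
    simp only [mxX, List.length_cons]
    constructor
    · rw [h.comm, h.infc _ (h.a2 _ _ _), ih.2]
    · rw [show w.length + 1 + 2 = w.length + 3 by ring, h.per, h.idem]

theorem MxSim.mono_z (h : MxSim c M T R Z E a z) (l : ℕ) {x y : B} (hxy : x ⊓ z ≤ y) :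
    c l x ⊓ z ≤ c l y := by
  rw [← h.infc l (h.zc l)]; exact h.mono l hxy

theorem MxSim.x_zero (h : MxSim c M T R Z E a z) (w : List (K × G)) (k : K)
    (hk : mxStk w k = []) : mxX c E a w ⊓ z ≤ Z k w.length := by
  induction w with
  | nil => exact h.e0 k 0
  | cons p w ih =>
    have hp : p.1 ≠ k := by
      rintro rfl
      simp [mxStk] at hk
    have hk' : mxStk w k = [] := by
      simpa [mxStk, Function.update_of_ne (Ne.symm hp)] using hk
    have h1 := ih hk'
    have h2 : c w.length (Z k (w.length + 1)) = Z k (w.length + 1) := by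
      rw [← h.per]; exact h.Z2 k (w.length + 1)
    simp only [mxX, List.length_cons]
    rw [← h2]
    apply h.mono_z
    refine le_trans ?_ (h.zp p.1 k p.2 w.length hp)
    refine le_inf (le_inf (le_trans ?_ h1) ?_) inf_le_right
    · exact inf_le_inf_right _ inf_le_left
    · exact inf_le_left.trans inf_le_right

theorem MxSim.x_pop (h : MxSim c M T R Z E a z) (w : List (K × G)) (k : K) (g : G) (t : List G)
    (hk : mxStk w k = g :: t) : ∃ w', mxStk w' = Function.update (mxStk w) k t ∧
      w.length = w'.length + 1 ∧ mxX c E a w ⊓ z ≤ c w'.length (mxX c E a w' ⊓ a k g w'.length) := by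
  induction w generalizing t with
  | nil => simp [mxStk] at hk
  | cons p w ih =>
    by_cases hp : p.1 = k
    · subst hp
      simp only [mxStk, Function.update_self, List.cons.injEq] at hk
      obtain ⟨h1, h2⟩ := hk
      refine ⟨w, ?_, rfl, ?_⟩
      · simp [mxStk, ← h2]
      · rw [← h1]; exact inf_le_left
    · have hk' : mxStk w k = g :: t := by
        simpa [mxStk, Function.update_of_ne (Ne.symm hp)] using hk
      obtain ⟨w', h1, h2, h3⟩ := ih t hk'
      refine ⟨p :: w', ?_, by simp [h2], ?_⟩
      · simp only [mxStk]
        rw [h1, Function.update_of_ne hp, Function.update_comm hp]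
      · simp only [mxX, List.length_cons, h2]
        generalize hL : w'.length = L at *
        have hx := (h.x_closed w').1
        rw [hL] at hx
        have haL : ∀ k g, c L (a k g (L+1)) = a k g (L+1) := fun k g => by
          rw [← h.per]; exact h.a2 k g (L+1)
        have key : ∀ k g k' g', c (L+1) (c L (mxX c E a w' ⊓ a k g L) ⊓ a k' g' (L+1)) =
            c L (mxX c E a w' ⊓ c (L+1) (a k g L ⊓ a k' g' (L+1))) := fun k g k' g' => by
          rw [← h.infc L (haL _ _), h.comm, inf_assoc, h.infc' _ hx]
        rw [key]
        calc _ ≤ c (L+1) (c L (mxX c E a w' ⊓ a k g L) ⊓ a p.1 p.2 (L+1)) ⊓ z := by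
                refine le_inf ?_ inf_le_right
                apply h.mono_z
                refine le_inf (le_trans ?_ h3) (inf_le_left.trans inf_le_right)
                exact inf_le_inf_right _ inf_le_left
          _ = c L (mxX c E a w' ⊓ c (L+1) (a k g L ⊓ a p.1 p.2 (L+1))) ⊓ z := by rw [key]
          _ ≤ _ := by
                apply h.mono_z
                rw [inf_assoc]
                exact inf_le_inf_left _ (h.com _ _ _ _ _ (Ne.symm hp))

def MxD (c : ℕ → B → B) (R : TM2.Stmt (fun _ : K => G) Λ σ → σ → ℕ → B) (E : ℕ → B)
    (a : K → G → ℕ → B) (z : B) (q : TM2.Stmt (fun _ : K => G) Λ σ) (v : σ) (S : K → List G) :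
    Prop :=
  ∀ w, mxStk w = S → R q v w.length ⊓ mxX c E a w ⊓ z = ⊥

theorem mx_bot_of_le {p q : B} (hq : q = ⊥) (h : p ≤ q) : p = ⊥ := le_bot_iff.1 (hq ▸ h)

theorem MxSim.d_nop (q q' v v' S)
    (hr : ∀ l, R q v l ⊓ z ≤ R q' v' l)
    (hD : MxD c R E a z q' v' S) : MxD c R E a z q v S := by
  intro w hw
  refine mx_bot_of_le (hD w hw) ?_
  have := hr w.length
  refine le_inf (le_inf (le_trans ?_ this) ?_) inf_le_right
  · exact inf_le_inf_right _ inf_le_left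
  · exact inf_le_left.trans inf_le_right

theorem MxSim.d_zero (h : MxSim c M T R Z E a z) (q q' v v' S k) (hS : S k = [])
    (hr : ∀ l, R q v l ⊓ Z k l ⊓ z ≤ R q' v' l)
    (hD : MxD c R E a z q' v' S) : MxD c R E a z q v S := by
  intro w hw
  refine mx_bot_of_le (hD w hw) ?_
  have h1 := h.x_zero w k (by rw [hw, hS])
  refine le_inf (le_inf (le_trans (le_inf (le_inf ?_ (le_trans ?_ h1)) inf_le_right)
    (hr w.length)) ?_) inf_le_right
  · exact inf_le_left.trans inf_le_left
  · exact inf_le_inf_right _ inf_le_right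
  · exact inf_le_left.trans inf_le_right

theorem MxSim.d_pop (h : MxSim c M T R Z E a z) (q q' v v' S k g t) (hS : S k = g :: t)
    (hr : ∀ l, R q v (l+1) ⊓ a k g l ⊓ z ≤ R q' v' l)
    (hD : MxD c R E a z q' v' (Function.update S k t)) : MxD c R E a z q v S := by
  intro w hw
  obtain ⟨w', h1, h2, h3⟩ := h.x_pop w k g t (by rw [hw, hS])
  have hR : c w'.length (R q v (w'.length + 1)) = R q v (w'.length + 1) := by
    rw [← h.per]; exact h.R2 _ _ _
  have hD' := hD w' (by rw [h1, hw])
  have h4 : R q v (w'.length + 1) ⊓ z ⊓ c w'.length (mxX c E a w' ⊓ a k g w'.length) = ⊥ := by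
    rw [← h.infc']
    · refine mx_bot_of_le (h.bot w'.length) (h.mono _ ?_)
      rw [← hD']
      refine le_inf (le_inf (le_trans ?_ (hr w'.length)) ?_) ?_
      · refine le_inf (le_inf ?_ ?_) ?_
        · exact inf_le_left.trans inf_le_left
        · exact inf_le_right.trans inf_le_right
        · exact inf_le_left.trans inf_le_right
      · exact inf_le_right.trans inf_le_left
      · exact inf_le_left.trans inf_le_right
    · rw [h.infc _ (h.zc _), hR]
  refine mx_bot_of_le h4 ?_
  rw [h2]
  refine le_inf (le_inf ?_ inf_le_right) (le_trans ?_ h3)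
  · exact inf_le_left.trans inf_le_left
  · exact inf_le_inf_right _ inf_le_right

theorem MxSim.d_peek (h : MxSim c M T R Z E a z) (q q' v v' S k g t) (hS : S k = g :: t)
    (hr : ∀ l, R q v (l+1) ⊓ a k g l ⊓ z ≤ R q' v' (l+1))
    (hD : MxD c R E a z q' v' S) : MxD c R E a z q v S := by
  intro w hw
  obtain ⟨w', h1, h2, h3⟩ := h.x_pop w k g t (by rw [hw, hS])
  have hR : ∀ q v, c w'.length (R q v (w'.length + 1)) = R q v (w'.length + 1) := fun q v => by
    rw [← h.per]; exact h.R2 _ _ _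
  have hD' := hD w hw
  have h4 : R q v (w'.length + 1) ⊓ z ⊓ c w'.length (mxX c E a w' ⊓ a k g w'.length)
      ≤ R q' v' (w'.length + 1) := by
    rw [← h.infc']
    · rw [← hR q' v']
      refine h.mono _ (le_trans ?_ (hr w'.length))
      refine le_inf (le_inf ?_ ?_) ?_
      · exact inf_le_left.trans inf_le_left
      · exact inf_le_right.trans inf_le_right
      · exact inf_le_left.trans inf_le_right
    · rw [h.infc _ (h.zc _), hR]
  rw [h2] at hD' ⊢
  refine mx_bot_of_le hD' (le_inf (le_inf (le_trans ?_ h4) ?_) inf_le_right)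
  · refine le_inf (le_inf ?_ inf_le_right) (le_trans ?_ h3)
    · exact inf_le_left.trans inf_le_left
    · exact inf_le_inf_right _ inf_le_right
  · exact inf_le_left.trans inf_le_right

theorem MxSim.d_push (h : MxSim c M T R Z E a z) (q q' v v' S k g)
    (hr : ∀ l, R q v l ⊓ a k g l ⊓ z ≤ R q' v' (l+1))
    (hD : MxD c R E a z q' v' (Function.update S k (g :: S k))) : MxD c R E a z q v S := by
  intro w hw
  have hD' := hD ((k,g) :: w) (by simp [mxStk, hw])
  simp only [List.length_cons, mxX] at hD'
  have hcl : c (w.length + 1) (R q v w.length ⊓ mxX c E a w ⊓ z) =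
      R q v w.length ⊓ mxX c E a w ⊓ z := by
    rw [h.infc _ (h.zc _), h.infc _ (h.x_closed w).1, h.R1]
  have h1 : R q v w.length ⊓ mxX c E a w ⊓ z ≤
      c (w.length + 1) (R q v w.length ⊓ mxX c E a w ⊓ z ⊓ a k g w.length) := by
    rw [h.infc' _ hcl]
    exact le_inf le_rfl (inf_le_right.trans (h.ser _ _ _))
  refine mx_bot_of_le (h.bot (w.length + 1)) (h1.trans (h.mono _ ?_))
  rw [← hD']
  refine le_inf (le_inf (le_trans ?_ (hr w.length)) (le_trans ?_ (h.le w.length _))) ?_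
  · refine le_inf (le_inf ?_ inf_le_right) (inf_le_left.trans inf_le_right)
    exact inf_le_left.trans (inf_le_left.trans inf_le_left)
  · exact inf_le_inf_right _ (inf_le_left.trans inf_le_right)
  · exact inf_le_left.trans inf_le_right

def MxDC (M : Λ → TM2.Stmt (fun _ : K => G) Λ σ)
    (T : Set (TM2.Stmt (fun _ : K => G) Λ σ))
    (c : ℕ → B → B) (R : TM2.Stmt (fun _ : K => G) Λ σ → σ → ℕ → B) (E : ℕ → B)
    (a : K → G → ℕ → B) (z : B) (x : TM2.Cfg (fun _ : K => G) Λ σ) : Prop :=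
  ∀ l, x.l = some l → M l ∈ T → MxD c R E a z (M l) x.var x.stk

theorem MxSim.d_aux (h : MxSim c M T R Z E a z) (hT : MxClosed M T)
    (q : TM2.Stmt (fun _ : K => G) Λ σ) (hq : q ∈ T) (v : σ) (S : K → List G)
    (hx : MxDC M T c R E a z (TM2.stepAux q v S)) : MxD c R E a z q v S := by
  induction q generalizing v S with
  | push k f q ih =>
    exact h.d_push _ q v v S k (f v) (fun l => h.push k f q v l hq)
      (ih (hT.push _ _ _ hq) _ _ hx)
  | peek k f q ih =>
    have hx' := ih (hT.peek _ _ _ hq) _ _ hx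
    cases hS : S k with
    | nil =>
      rw [hS] at hx'
      exact h.d_zero _ q v _ S k hS (fun l => h.peek0 k f q v l hq) hx'
    | cons g t =>
      rw [hS] at hx'
      exact h.d_peek _ q v _ S k g t hS (fun l => h.peek k f q v g l hq) hx'
  | pop k f q ih =>
    have hx' := ih (hT.pop _ _ _ hq) _ _ hx
    cases hS : S k with
    | nil =>
      rw [hS] at hx'
      have : Function.update S k [] = S := by rw [← hS]; simp
      simp only [List.head?_nil, List.tail_nil, this] at hx'
      exact h.d_zero _ q v _ S k hS (fun l => h.pop0 k f q v l hq) hx'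
    | cons g t =>
      rw [hS] at hx'
      exact h.d_pop _ q v _ S k g t hS (fun l => h.pop k f q v g l hq) hx'
  | load f q ih =>
    exact MxSim.d_nop _ _ _ _ _ (fun l => h.load f q v l hq) (ih (hT.load _ _ hq) _ _ hx)
  | branch f q q' ih ih' =>
    refine MxSim.d_nop _ _ _ _ _ (fun l => h.branch f q q' v l hq) ?_
    simp only [TM2.stepAux] at hx
    cases hf : f v with
    | true => rw [hf] at hx; exact ih (hT.branch _ _ _ hq).1 _ _ hx
    | false => rw [hf] at hx; exact ih' (hT.branch _ _ _ hq).2 _ _ hx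
  | goto f =>
    exact MxSim.d_nop _ _ _ _ _ (fun l => h.goto f v l hq) (hx (f v) rfl (hT.goto _ hq v))
  | halt =>
    intro w _
    refine mx_bot_of_le (h.halt v w.length hq) ?_
    exact inf_le_inf_right _ inf_le_left

theorem MxSim.main (h : MxSim c M T R Z E a z) (hT : MxClosed M T)
    (q : TM2.Stmt (fun _ : K => G) Λ σ) (hq : q ∈ T) (v : σ) (S : K → List G)
    (hx : (StateTransition.eval (TM2.step M) (TM2.stepAux q v S)).Dom) :
    MxD c R E a z q v S := by
  apply h.d_aux hT q hq
  obtain ⟨b, hb⟩ := Part.dom_iff_mem.1 hx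
  refine StateTransition.evalInduction (C := fun x => MxDC M T c R E a z x) hb ?_
  rintro ⟨l, v, S⟩ _ ih l' hl hM
  simp only at hl
  subst hl
  exact h.d_aux hT _ hM _ _ (ih _ rfl)

end
end MadduxAbstract
section MadduxTerms
open Turing

def CAlg.mxDf {n : ℕ} (A : CAlg (n : ℕ∞)) : DfAlg n where
  carrier := A.carrier
  c := A.c
  c_bot := fun i hi => A.c_bot i (by exact_mod_cast hi)
  le_c := fun i hi => A.le_c i (by exact_mod_cast hi)
  c_inf_c := fun i hi => A.c_inf_c i (by exact_mod_cast hi)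
  c_c := fun i j hi hj => A.c_c i j (by exact_mod_cast hi) (by exact_mod_cast hj)

def DfTerm.mxEmb {n : ℕ} : DfTerm n → CTerm n
  | var i => .var i
  | bot => .bot
  | top => .top
  | sup s t => .sup s.mxEmb t.mxEmb
  | inf s t => .inf s.mxEmb t.mxEmb
  | compl t => .compl t.mxEmb
  | cyl i t => .cyl i t.mxEmb

theorem DfTerm.mxEmb_code {n : ℕ} (t : DfTerm n) : t.mxEmb.code = t.code := by
  induction t <;> simp_all [DfTerm.mxEmb, CTerm.code, DfTerm.code]

theorem DfTerm.mxEmb_eval {n : ℕ} (A : CAlg (n : ℕ∞)) (v : ℕ → A.carrier) (t : DfTerm n) :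
    t.mxEmb.eval A v = t.eval A.mxDf v := by
  induction t <;> simp_all [DfTerm.mxEmb, CTerm.eval, DfTerm.eval] <;> rfl

theorem DfTerm.mxCode_inj {n : ℕ} : Function.Injective (DfTerm.code (n := n)) := by
  intro s
  induction s <;> intro t <;> cases t <;>
    simp_all [DfTerm.code, Nat.pair_eq_pair, Fin.ext_iff] <;> grind

theorem CTerm.mxCode_inj {n : ℕ} : Function.Injective (CTerm.code (n := n)) := by
  intro s
  induction s <;> intro t <;> cases t <;>
    simp_all [CTerm.code, Nat.pair_eq_pair, Fin.ext_iff] <;> grind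

/-- the full cylindric set algebra -/
noncomputable def mxStd (n : ℕ) (U : Type) : CAlg (n : ℕ∞) where
  carrier := Set (Fin n → U)
  c := fun i X => {s | ∀ h : i < n, ∃ u, Function.update s ⟨i, h⟩ u ∈ X}
  d := fun i j => {s | ∀ (hi : i < n) (hj : j < n), s ⟨i, hi⟩ = s ⟨j, hj⟩}
  c_bot := fun i hi => by
    have hi' : i < n := by exact_mod_cast hi
    ext s; simp [hi']
  le_c := fun i hi x s hs h => ⟨s ⟨i, h⟩, by simpa using hs⟩
  c_inf_c := fun i hi x y => by
    have hi' : i < n := by exact_mod_cast hi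
    ext s
    simp [hi']
  c_c := fun i j hi hj x => by
    have hi' : i < n := by exact_mod_cast hi
    have hj' : j < n := by exact_mod_cast hj
    by_cases hij : i = j
    · subst hij; rfl
    have hne : (⟨i, hi'⟩ : Fin n) ≠ ⟨j, hj'⟩ := by simpa using hij
    ext s
    simp only [Set.mem_ofPred_eq, hi', hj', forall_true_left]
    constructor
    · rintro ⟨u, u', h⟩; exact ⟨u', u, by rwa [Function.update_comm hne.symm]⟩
    · rintro ⟨u, u', h⟩; exact ⟨u', u, by rwa [Function.update_comm hne]⟩
  d_refl := fun i hi => by ext s; simp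
  d_exp := fun i j k hi hj hk hij hik => by
    have hi' : i < n := by exact_mod_cast hi
    have hj' : j < n := by exact_mod_cast hj
    have hk' : k < n := by exact_mod_cast hk
    have h1 : (⟨j, hj'⟩ : Fin n) ≠ ⟨i, hi'⟩ := by simpa using Ne.symm hij
    have h2 : (⟨k, hk'⟩ : Fin n) ≠ ⟨i, hi'⟩ := by simpa using Ne.symm hik
    ext s
    simp [hi', hj', hk', Ne.symm hij, Ne.symm hik]
  d_disj := fun i j hi hj hij x => by
    have hi' : i < n := by exact_mod_cast hi
    have hj' : j < n := by exact_mod_cast hj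
    ext s
    simp [hi', hj', Ne.symm hij]

variable {n : ℕ}

theorem mx_exists_sup (F : Set (DfTerm n)) (hF : F.Finite) : ∃ H : DfTerm n,
    (∀ (A : DfAlg n) v, ∀ t ∈ F, t.eval A v ≤ H.eval A v) ∧
    (∀ (A : DfAlg n) v, (∀ t ∈ F, t.eval A v = ⊥) → H.eval A v = ⊥) := by
  induction F, hF using Set.Finite.induction_on with
  | empty => exact ⟨.bot, by simp, by simp [DfTerm.eval]⟩
  | insert _ _ ih =>
    rename_i t F _ _
    obtain ⟨H, h1, h2⟩ := ih
    refine ⟨.sup t H, ?_, ?_⟩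
    · rintro A v t' (rfl | ht')
      · exact le_sup_left
      · exact (h1 A v t' ht').trans le_sup_right
    · intro A v h
      simp only [DfTerm.eval]
      rw [h t (by simp), h2 A v (fun t' ht' => h t' (by simp [ht']))]
      simp

theorem mx_exists_H (F : Set (DfTerm n)) (hF : F.Finite) (S : DfAlg n) (val : ℕ → S.carrier) :
    ∃ H : DfTerm n, H.eval S val = ⊥ ∧ ∀ p ∈ F, ∀ q ∈ F, ∀ r ∈ F,
      p.eval S val ⊓ q.eval S val ≤ r.eval S val → ∀ (A : DfAlg n) v,
      p.eval A v ⊓ q.eval A v ⊓ (H.eval A v)ᶜ ≤ r.eval A v := by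
  let m : DfTerm n × DfTerm n × DfTerm n → DfTerm n := fun x => .inf (.inf x.1 x.2.1) (.compl x.2.2)
  have hf : (m '' (F ×ˢ F ×ˢ F)).Finite := (hF.prod (hF.prod hF)).image m
  obtain ⟨H, h1, h2⟩ := mx_exists_sup
    {t | t ∈ m '' (F ×ˢ F ×ˢ F) ∧ t.eval S val = ⊥} (hf.subset fun t ht => ht.1)
  refine ⟨H, h2 S val fun t ht => ht.2, ?_⟩
  intro p hp q hq r hr hle A v
  have := h1 A v (m (p, q, r)) ⟨⟨_, ⟨hp, hq, hr⟩, rfl⟩, by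
    simp only [m, DfTerm.eval]
    rwa [← disjoint_iff, ← le_compl_iff_disjoint_right, compl_compl]⟩
  simp only [m, DfTerm.eval] at this
  rw [← sdiff_eq, sdiff_le_iff] at this ⊢
  rwa [sup_comm]

theorem mx_finite_per {α X : Type} [Finite α] (f : α → ℕ → X)
    (hf : ∀ a l, f a l = f a (l % 3)) : {x | ∃ a l, f a l = x}.Finite := by
  refine (Set.finite_range (fun y : α × Fin 3 => f y.1 y.2)).subset ?_
  rintro _ ⟨a, l, rfl⟩
  exact ⟨(a, ⟨l % 3, Nat.mod_lt _ (by norm_num)⟩), (hf a l).symm⟩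

def mxCo (hn : 3 ≤ n) (l : ℕ) : Fin n := ⟨l % 3, by omega⟩

theorem mxCo_ne1 (hn : 3 ≤ n) (l : ℕ) : mxCo hn l ≠ mxCo hn (l+1) := by
  simp only [mxCo, ne_eq, Fin.mk.injEq]; omega
theorem mxCo_ne2 (hn : 3 ≤ n) (l : ℕ) : mxCo hn l ≠ mxCo hn (l+2) := by
  simp only [mxCo, ne_eq, Fin.mk.injEq]; omega
theorem mxCo_per (hn : 3 ≤ n) (l : ℕ) : mxCo hn (l+3) = mxCo hn l := by
  simp [mxCo]
theorem mxCo_mod (hn : 3 ≤ n) (l : ℕ) : mxCo hn (l % 3) = mxCo hn l := by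
  simp [mxCo]
theorem mxCo_mod1 (hn : 3 ≤ n) (l : ℕ) : mxCo hn (l % 3 + 1) = mxCo hn (l + 1) := by
  simp [mxCo]
theorem mxCo_mod2 (hn : 3 ≤ n) (l : ℕ) : mxCo hn (l % 3 + 2) = mxCo hn (l + 2) := by
  simp [mxCo]

abbrev MxSym (K G σ : Type) := (ℕ × σ × ℕ) ⊕ (K × ℕ) ⊕ ℕ ⊕ (K × G × ℕ)

variable {K G Λ σ : Type} (hn : 3 ≤ n) (e : MxSym K G σ → ℕ)
  (nm : TM2.Stmt (fun _ : K => G) Λ σ → ℕ)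

def mxUn (l : ℕ) (s : MxSym K G σ) : DfTerm n :=
  .cyl (mxCo hn (l+1)) (.cyl (mxCo hn (l+2)) (.var (e s)))

def mxTR (q : TM2.Stmt (fun _ : K => G) Λ σ) (v : σ) (l : ℕ) : DfTerm n :=
  mxUn hn e l (.inl (nm q, v, l % 3))
def mxTZ (k : K) (l : ℕ) : DfTerm n := mxUn hn e l (.inr (.inl (k, l % 3)))
def mxTE (l : ℕ) : DfTerm n := mxUn hn e l (.inr (.inr (.inl (l % 3))))
def mxTA (k : K) (g : G) (l : ℕ) : DfTerm n :=
  .cyl (mxCo hn (l+2)) (.var (e (.inr (.inr (.inr (k, g, l % 3))))))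
def mxTS (k : K) (g : G) (l : ℕ) : DfTerm n := .cyl (mxCo hn (l+1)) (mxTA hn e k g l)
def mxTC (k : K) (g : G) (k' : K) (g' : G) (l : ℕ) : DfTerm n :=
  .cyl (mxCo hn (l+1)) (.inf (mxTA hn e k g l) (mxTA hn e k' g' (l+1)))

def mxF (T : Set (TM2.Stmt (fun _ : K => G) Λ σ)) : Set (DfTerm n) :=
  {x | ∃ (y : T × σ) (l : ℕ), mxTR hn e nm y.1 y.2 l = x} ∪
  {x | ∃ (y : K) (l : ℕ), mxTZ hn e y l = x} ∪
  {x | ∃ (_ : Unit) (l : ℕ), mxTE hn e l = x} ∪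
  {x | ∃ (y : K × G) (l : ℕ), mxTA hn e y.1 y.2 l = x} ∪
  {x | ∃ (y : K × G) (l : ℕ), mxTS hn e y.1 y.2 l = x} ∪
  {x | ∃ (y : (K × G) × (K × G)) (l : ℕ), mxTC hn e y.1.1 y.1.2 y.2.1 y.2.2 l = x} ∪
  {.top, .bot}

theorem mxF_finite [Finite K] [Finite G] [Finite σ] (T : Set (TM2.Stmt (fun _ : K => G) Λ σ))
    (hT : T.Finite) : (mxF hn e nm T).Finite := by
  have : Finite T := hT
  unfold mxF
  refine ((((((?_ : Set.Finite _).union ?_).union ?_).union ?_).union ?_).union ?_).union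
    (Set.toFinite _) <;> apply mx_finite_per <;> intro a l
  · simp [mxTR, mxUn, mxCo_mod1, mxCo_mod2]
  · simp [mxTZ, mxUn, mxCo_mod1, mxCo_mod2]
  · simp [mxTE, mxUn, mxCo_mod1, mxCo_mod2]
  · simp [mxTA, mxUn, mxCo_mod1, mxCo_mod2]
  · simp [mxTS, mxTA, mxUn, mxCo_mod1, mxCo_mod2]
  · have h1 : mxCo hn (l % 3 + 1 + 2) = mxCo hn (l + 1 + 2) := by simp only [mxCo, Fin.mk.injEq]; omega
    simp [mxTC, mxTA, mxUn, mxCo_mod1, mxCo_mod2, h1]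

/-- the term for a word of pushes -/
def mxTX (w : List (K × G)) : DfTerm n :=
  match w with
  | [] => mxTE hn e 0
  | p :: w => .cyl (mxCo hn w.length) (.inf (mxTX w) (mxTA hn e p.1 p.2 w.length))

theorem mxTX_eval (A : DfAlg n) (v : ℕ → A.carrier) (w : List (K × G)) :
    (mxTX hn e w).eval A v = mxX (fun l x => A.c (mxCo hn l) x) (fun l => (mxTE hn e l).eval A v)
      (fun k g l => (mxTA hn e k g l).eval A v) w := by
  induction w with
  | nil => rfl
  | cons p w ih => simp only [mxTX, mxX, DfTerm.eval, ih]

theorem mx_cyl (A : DfAlg n) : MxCyl (fun l x => A.c (mxCo hn l) x) where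
  bot := fun l => A.c_bot _ (mxCo hn l).2
  le := fun l => A.le_c _ (mxCo hn l).2
  inf := fun l => A.c_inf_c _ (mxCo hn l).2
  comm := fun l m => A.c_c _ _ (mxCo hn l).2 (mxCo hn m).2
  per := fun l x => by simp [mxCo_per]

end MadduxTerms
section MadduxStd
open Turing

variable {n : ℕ} {K G Λ σ : Type} [DecidableEq K] (hn : 3 ≤ n) (e : MxSym K G σ → ℕ)
  (nm : TM2.Stmt (fun _ : K => G) Λ σ → ℕ) (M : Λ → TM2.Stmt (fun _ : K => G) Λ σ)
  (T : Set (TM2.Stmt (fun _ : K => G) Λ σ))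

def MxGood (q : TM2.Stmt (fun _ : K => G) Λ σ) (v : σ) (S : K → List G) : Prop :=
  (StateTransition.eval (TM2.step M) (TM2.stepAux q v S)).Dom

def mxSymVal : MxSym K G σ → Set (Fin n → (K → List G))
  | .inl (m, v, i) => {s | ∃ q ∈ T, nm q = m ∧ ¬ MxGood M q v (s (mxCo hn i))}
  | .inr (.inl (k, i)) => {s | s (mxCo hn i) k = []}
  | .inr (.inr (.inl i)) => {s | s (mxCo hn i) = fun _ => []}
  | .inr (.inr (.inr (k, g, i))) =>
    {s | s (mxCo hn (i+1)) = Function.update (s (mxCo hn i)) k (g :: s (mxCo hn i) k)}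

noncomputable def mxVal : ℕ → Set (Fin n → (K → List G)) :=
  Function.extend e (mxSymVal hn nm M T) ⊥

noncomputable abbrev mxStdD (n : ℕ) (U : Type) : DfAlg n := (mxStd n U).mxDf

def mxSEv {U : Type} (val : ℕ → Set (Fin n → U)) : DfTerm n → Set (Fin n → U)
  | .var i => val i
  | .bot => ∅
  | .top => Set.univ
  | .sup s t => mxSEv val s ∪ mxSEv val t
  | .inf s t => mxSEv val s ∩ mxSEv val t
  | .compl t => (mxSEv val t)ᶜ
  | .cyl i t => {s | ∃ u, Function.update s i u ∈ mxSEv val t}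

theorem mxSEv_eq {U : Type} (val : ℕ → Set (Fin n → U)) (t : DfTerm n) :
    t.eval (mxStdD n U) val = mxSEv val t := by
  induction t with
  | var i => rfl
  | bot => rfl
  | top => rfl
  | sup s t h1 h2 => simp only [DfTerm.eval, mxSEv, h1, h2]; rfl
  | inf s t h1 h2 => simp only [DfTerm.eval, mxSEv, h1, h2]; rfl
  | compl t h => simp only [DfTerm.eval, mxSEv, h]; rfl
  | cyl i t h =>
    simp only [DfTerm.eval, mxSEv, h]
    refine Set.ext (α := Fin n → U) fun s => ?_
    change (∀ h : i.1 < n, ∃ u, Function.update s ⟨i.1, h⟩ u ∈ mxSEv val t) ↔ _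
    simp

noncomputable abbrev mxEv (t : DfTerm n) : Set (Fin n → (K → List G)) :=
  mxSEv (mxVal hn e nm M T) t

variable {e nm T}

theorem mxEv_un (he : Function.Injective e) (l : ℕ) (s : MxSym K G σ)
    (f : Fin n → (K → List G)) : f ∈ mxEv hn e nm M T (mxUn hn e l s) ↔
      ∃ u u', Function.update (Function.update f (mxCo hn (l+1)) u) (mxCo hn (l+2)) u' ∈
        mxSymVal hn nm M T s := by
  simp only [mxUn, mxEv, mxSEv, mxVal, he.extend_apply]
  rfl

theorem mxEv_R (he : Function.Injective e) (hnm : Set.InjOn nm T) (q) (hq : q ∈ T) (v : σ) (l : ℕ)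
    (f : Fin n → (K → List G)) : f ∈ mxEv hn e nm M T (mxTR hn e nm q v l) ↔
      ¬ MxGood M q v (f (mxCo hn l)) := by
  rw [mxTR, mxEv_un hn M he]
  simp only [mxSymVal, Set.mem_ofPred_eq, mxCo_mod, Function.update_of_ne (mxCo_ne1 hn l),
    Function.update_of_ne (mxCo_ne2 hn l), exists_const]
  constructor
  · rintro ⟨q', h1, h2, h3⟩
    rwa [← hnm h1 hq h2]
  · exact fun h => ⟨q, hq, rfl, h⟩

theorem mxEv_Z (he : Function.Injective e) (k : K) (l : ℕ)
    (f : Fin n → (K → List G)) : f ∈ mxEv hn e nm M T (mxTZ hn e k l) ↔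
      f (mxCo hn l) k = [] := by
  rw [mxTZ, mxEv_un hn M he]
  simp only [mxSymVal, Set.mem_ofPred_eq, mxCo_mod, Function.update_of_ne (mxCo_ne1 hn l),
    Function.update_of_ne (mxCo_ne2 hn l), exists_const]

theorem mxEv_E (he : Function.Injective e) (l : ℕ)
    (f : Fin n → (K → List G)) : f ∈ mxEv hn e nm M T (mxTE hn e l) ↔
      f (mxCo hn l) = fun _ => [] := by
  rw [mxTE, mxEv_un hn M he]
  simp only [mxSymVal, Set.mem_ofPred_eq, mxCo_mod, Function.update_of_ne (mxCo_ne1 hn l),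
    Function.update_of_ne (mxCo_ne2 hn l), exists_const]

theorem mxEv_A (he : Function.Injective e) (k : K) (g : G) (l : ℕ)
    (f : Fin n → (K → List G)) : f ∈ mxEv hn e nm M T (mxTA hn e k g l) ↔
      f (mxCo hn (l+1)) = Function.update (f (mxCo hn l)) k (g :: f (mxCo hn l) k) := by
  simp only [mxTA, mxEv, mxSEv, mxVal, he.extend_apply, Set.mem_ofPred_eq]
  simp only [mxSymVal, Set.mem_ofPred_eq, mxCo_mod, mxCo_mod1,
    Function.update_of_ne (mxCo_ne1 hn (l+1)),
    Function.update_of_ne (mxCo_ne2 hn l), exists_const]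

theorem mxEv_S (he : Function.Injective e) (k : K) (g : G) (l : ℕ)
    (f : Fin n → (K → List G)) : f ∈ mxEv hn e nm M T (mxTS hn e k g l) := by
  simp only [mxTS, mxEv, mxSEv]
  change ∃ u, _ ∈ mxEv hn e nm M T _
  simp only [mxEv_A hn M he, Function.update_self, Function.update_of_ne (mxCo_ne1 hn l),
    exists_eq]

theorem mxEv_C (he : Function.Injective e) (k : K) (g : G) (k' : K) (g' : G) (l : ℕ)
    (f : Fin n → (K → List G)) : f ∈ mxEv hn e nm M T (mxTC hn e k g k' g' l) ↔
      ∃ u, u = Function.update (f (mxCo hn l)) k (g :: f (mxCo hn l) k) ∧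
       f (mxCo hn (l+1+1)) = Function.update u k' (g' :: u k') := by
  simp only [mxTC, mxEv, mxSEv]
  refine exists_congr fun u => ?_
  refine (and_congr (mxEv_A hn M he k g l _) (mxEv_A hn M he k' g' (l+1) _)).trans ?_
  simp only [Function.update_self, Function.update_of_ne (mxCo_ne1 hn l),
    Function.update_of_ne (mxCo_ne1 hn (l+1)).symm]

theorem mxEv_X (he : Function.Injective e) (w : List (K × G)) (f : Fin n → (K → List G))
    (hf : f (mxCo hn w.length) = mxStk w) : f ∈ mxEv hn e nm M T (mxTX hn e w) := by
  induction w generalizing f with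
  | nil => exact (mxEv_E hn M he 0 f).2 hf
  | cons p w ih =>
    simp only [mxTX, mxEv, mxSEv]
    refine ⟨mxStk w, ih _ (by simp), (mxEv_A hn M he _ _ _ _).2 ?_⟩
    rw [Function.update_of_ne (mxCo_ne1 hn _).symm, Function.update_self]
    exact hf

theorem mxGood_goto (f : σ → Λ) (v : σ) (S : K → List G) :
    MxGood M (.goto f) v S ↔ MxGood M (M (f v)) v S := by
  unfold MxGood
  rw [StateTransition.reaches_eval (b := TM2.stepAux (M (f v)) v S)]
  exact Relation.ReflTransGen.single rfl

theorem mxGood_halt (v : σ) (S : K → List G) : MxGood M .halt v S := by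
  unfold MxGood
  rw [Part.dom_iff_mem]
  exact ⟨_, StateTransition.mem_eval.2 ⟨Relation.ReflTransGen.refl, rfl⟩⟩


theorem mxCyl_closed3 {B : Type} [BooleanAlgebra B] {c : ℕ → B → B} (h : MxCyl c)
    (hm : ∀ l x, c (l % 3) x = c l x) (l : ℕ) (x : B) :
    c l (c 0 (c 1 (c 2 x))) = c 0 (c 1 (c 2 x)) := by
  rw [← hm]
  have : l % 3 < 3 := Nat.mod_lt _ (by norm_num)
  generalize l % 3 = m at *
  interval_cases m
  · rw [h.idem]
  · rw [h.comm 1 0, h.idem]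
  · rw [h.comm 2 0, h.comm 2 1, h.idem]

theorem mx_sim [Finite K] [Finite G] [Finite σ] (he : Function.Injective e)
    (hnm : Set.InjOn nm T) (hT : MxClosed M T) (A : DfAlg n) (v : ℕ → A.carrier)
    (z : A.carrier) (hz : ∀ l, A.c (mxCo hn l) z = z)
    (h : ∀ p ∈ mxF hn e nm T, ∀ q ∈ mxF hn e nm T, ∀ r ∈ mxF hn e nm T,
      mxEv hn e nm M T p ∩ mxEv hn e nm M T q ⊆ mxEv hn e nm M T r →
      p.eval A v ⊓ q.eval A v ⊓ z ≤ r.eval A v) :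
    MxSim (fun l x => A.c (mxCo hn l) x) M T (fun q w l => (mxTR hn e nm q w l).eval A v)
      (fun k l => (mxTZ hn e k l).eval A v) (fun l => (mxTE hn e l).eval A v)
      (fun k g l => (mxTA hn e k g l).eval A v) z := by
  have hc := mx_cyl hn A
  have un1 : ∀ l s, A.c (mxCo hn (l+1)) ((mxUn hn e l s).eval A v) = (mxUn hn e l s).eval A v :=
    fun l s => hc.idem _ _
  have un2 : ∀ l s, A.c (mxCo hn (l+2)) ((mxUn hn e l s).eval A v) = (mxUn hn e l s).eval A v :=
    fun l s => by
      simp only [mxUn, DfTerm.eval]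
      rw [hc.comm (l+2) (l+1), hc.idem (l+2)]
  have fR : ∀ q ∈ T, ∀ w l, mxTR hn e nm q w l ∈ mxF hn e nm T := fun q hq w l =>
    .inl <| .inl <| .inl <| .inl <| .inl <| .inl ⟨(⟨q, hq⟩, w), l, rfl⟩
  have fZ : ∀ k l, mxTZ hn e k l ∈ mxF hn e nm T := fun k l =>
    .inl <| .inl <| .inl <| .inl <| .inl <| .inr ⟨k, l, rfl⟩
  have fE : ∀ l, mxTE hn e l ∈ mxF hn e nm T := fun l =>
    .inl <| .inl <| .inl <| .inl <| .inr ⟨(), l, rfl⟩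
  have fA : ∀ k g l, mxTA hn e k g l ∈ mxF hn e nm T := fun k g l =>
    .inl <| .inl <| .inl <| .inr ⟨(k, g), l, rfl⟩
  have fS : ∀ k g l, mxTS hn e k g l ∈ mxF hn e nm T := fun k g l =>
    .inl <| .inl <| .inr ⟨(k, g), l, rfl⟩
  have fC : ∀ k g k' g' l, mxTC hn e k g k' g' l ∈ mxF hn e nm T := fun k g k' g' l =>
    .inl <| .inr ⟨((k, g), (k', g')), l, rfl⟩
  have fT : DfTerm.top ∈ mxF hn e nm T := .inr (.inl rfl)
  have fB : DfTerm.bot ∈ mxF hn e nm T := .inr (.inr rfl)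
  have h2 : ∀ p ∈ mxF hn e nm T, ∀ r ∈ mxF hn e nm T,
      mxEv hn e nm M T p ⊆ mxEv hn e nm M T r → p.eval A v ⊓ z ≤ r.eval A v := by
    intro p hp r hr hpr
    have := h p hp _ fT r hr (fun s hs => hpr hs.1)
    simpa [DfTerm.eval] using this
  refine ⟨hc, hz, ?_, ?_, ?_, ?_, ?_, ?_, ?_, ?_, ?_, ?_, ?_, ?_, ?_, ?_, ?_, ?_, ?_, ?_, ?_⟩
  · exact fun q w l => un1 l _
  · exact fun q w l => un2 l _
  · exact fun q l => un2 l _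
  · exact fun l => un1 l _
  · exact fun l => un2 l _
  · exact fun k g l => hc.idem _ _
  · intro k g l
    have := h2 _ fT _ (fS k g l) (fun s _ => mxEv_S hn M he k g l s)
    simp only [DfTerm.eval, top_inf_eq] at this
    exact this
  · intro k k' g l hk
    refine h _ (fZ k' l) _ (fA k g l) _ (fZ k' (l+1)) ?_
    rintro s ⟨h1, h2⟩
    rw [mxEv_Z hn M he] at h1 ⊢
    rw [mxEv_A hn M he] at h2
    rw [h2, Function.update_of_ne hk.symm, h1]
  · intro k l
    refine h2 _ (fE l) _ (fZ k l) ?_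
    intro s h1
    rw [mxEv_E hn M he] at h1
    rw [mxEv_Z hn M he, h1]
  · intro k g k' g' l hk
    refine h2 _ (fC k g k' g' l) _ (fC k' g' k g l) ?_
    intro s h1
    rw [mxEv_C hn M he] at h1 ⊢
    obtain ⟨u, rfl, h1⟩ := h1
    refine ⟨_, rfl, ?_⟩
    rw [h1, Function.update_of_ne hk, Function.update_of_ne hk.symm, Function.update_comm hk]
  · intro k f q w l hq
    refine h _ (fR _ hq w l) _ (fA k (f w) l) _ (fR _ (hT.push _ _ _ hq) w (l+1)) ?_
    rintro s ⟨h1, h2⟩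
    rw [mxEv_R hn M he hnm _ hq] at h1
    rw [mxEv_A hn M he] at h2
    rw [mxEv_R hn M he hnm _ (hT.push _ _ _ hq), h2]
    exact h1
  · intro k f q w g l hq
    refine h _ (fR _ hq w (l+1)) _ (fA k g l) _ (fR _ (hT.pop _ _ _ hq) _ l) ?_
    rintro s ⟨h1, h2⟩
    rw [mxEv_R hn M he hnm _ hq] at h1
    rw [mxEv_A hn M he] at h2
    rw [mxEv_R hn M he hnm _ (hT.pop _ _ _ hq)]
    rw [h2] at h1
    simpa [MxGood] using h1
  · intro k f q w l hq
    refine h _ (fR _ hq w l) _ (fZ k l) _ (fR _ (hT.pop _ _ _ hq) _ l) ?_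
    rintro s ⟨h1, h2⟩
    rw [mxEv_R hn M he hnm _ hq] at h1
    rw [mxEv_Z hn M he] at h2
    rw [mxEv_R hn M he hnm _ (hT.pop _ _ _ hq)]
    have h3 : Function.update (s (mxCo hn l)) k [] = s (mxCo hn l) := by rw [← h2]; simp
    simpa [MxGood, h2, h3] using h1
  · intro k f q w g l hq
    refine h _ (fR _ hq w (l+1)) _ (fA k g l) _ (fR _ (hT.peek _ _ _ hq) _ (l+1)) ?_
    rintro s ⟨h1, h2⟩
    rw [mxEv_R hn M he hnm _ hq] at h1
    rw [mxEv_A hn M he] at h2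
    rw [mxEv_R hn M he hnm _ (hT.peek _ _ _ hq)]
    rw [h2] at h1 ⊢
    simpa [MxGood] using h1
  · intro k f q w l hq
    refine h _ (fR _ hq w l) _ (fZ k l) _ (fR _ (hT.peek _ _ _ hq) _ l) ?_
    rintro s ⟨h1, h2⟩
    rw [mxEv_R hn M he hnm _ hq] at h1
    rw [mxEv_Z hn M he] at h2
    rw [mxEv_R hn M he hnm _ (hT.peek _ _ _ hq)]
    simpa [MxGood, h2] using h1
  · intro f q w l hq
    refine h2 _ (fR _ hq w l) _ (fR _ (hT.load _ _ hq) _ l) ?_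
    intro s h1
    rw [mxEv_R hn M he hnm _ hq] at h1
    rw [mxEv_R hn M he hnm _ (hT.load _ _ hq)]
    exact h1
  · intro f q q' w l hq
    have hq' : cond (f w) q q' ∈ T := by
      cases f w
      · exact (hT.branch _ _ _ hq).2
      · exact (hT.branch _ _ _ hq).1
    refine h2 _ (fR _ hq w l) _ (fR _ hq' _ l) ?_
    intro s h1
    rw [mxEv_R hn M he hnm _ hq] at h1
    rw [mxEv_R hn M he hnm _ hq']
    cases hf : f w <;> simpa [MxGood, hf] using h1
  · intro f w l hq
    refine h2 _ (fR _ hq w l) _ (fR _ (hT.goto _ hq _) _ l) ?_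
    intro s h1
    rw [mxEv_R hn M he hnm _ hq] at h1
    rw [mxEv_R hn M he hnm _ (hT.goto _ hq _)]
    rwa [mxGood_goto] at h1
  · intro w l hq
    refine le_bot_iff.1 (h2 _ (fR _ hq w l) _ fB ?_)
    intro s h1
    rw [mxEv_R hn M he hnm _ hq] at h1
    exact absurd (mxGood_halt M _ _) h1

theorem mx_exists_term [Finite K] [Finite G] [Finite σ] (he : Function.Injective e)
    (hnm : Set.InjOn nm T) (hTf : T.Finite) (hT : MxClosed M T) : ∃ H : DfTerm n,
    ∀ q ∈ T, ∀ v w,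
      (MxGood M q v (mxStk w) → DfEqValid n
        (.inf (.inf (mxTR hn e nm q v w.length) (mxTX hn e w)) H) .bot) ∧
      (¬ MxGood M q v (mxStk w) →
        DfTerm.eval (mxStdD n (K → List G)) (mxVal hn e nm M T)
        (.inf (.inf (mxTR hn e nm q v w.length) (mxTX hn e w)) H) ≠ 
        DfTerm.eval (mxStdD n (K → List G)) (mxVal hn e nm M T) .bot) := by
  obtain ⟨H, hH1, hH2⟩ := mx_exists_H (mxF hn e nm T) (mxF_finite hn e nm T hTf)
    (mxStdD n (K → List G)) (mxVal hn e nm M T)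
  refine ⟨.compl (.cyl (mxCo hn 0) (.cyl (mxCo hn 1) (.cyl (mxCo hn 2) H))), ?_⟩
  intro q hq v w
  constructor
  · intro hg A val
    have hc := mx_cyl hn A
    have hz := mxCyl_closed3 hc (by intro l x; simp [mxCo_mod])
    have hs := mx_sim hn M he hnm hT A val
      (A.c (mxCo hn 0) (A.c (mxCo hn 1) (A.c (mxCo hn 2) (H.eval A val))))ᶜ
      (fun l => hc.compl l (hz l _)) (by
        intro p hp q hq r hr hpqr
        refine le_trans (inf_le_inf_left _ (compl_le_compl ?_)) (hH2 p hp q hq r hr ?_ A val)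
        · exact (hc.le 2 _).trans ((hc.le 1 _).trans (hc.le 0 _))
        · rw [mxSEv_eq, mxSEv_eq, mxSEv_eq]
          exact hpqr)
    have := hs.main hT q hq v (mxStk w) hg w rfl
    simp only [DfTerm.eval, mxTX_eval]
    exact this
  · intro hg
    have hb : ∀ l, (mxStdD n (K → List G)).c (mxCo hn l) ⊥ = ⊥ := fun l =>
      (mx_cyl hn (mxStdD n (K → List G))).bot l
    rw [mxSEv_eq, mxSEv_eq] 
    rw [mxSEv_eq] at hH1
    have hH1' : mxEv hn e nm M T H = ∅ := hH1
    intro h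
    have : (fun _ => mxStk w) ∈ mxSEv (mxVal hn e nm M T)
      (.inf (.inf (mxTR hn e nm q v w.length) (mxTX hn e w))
        (.compl (.cyl (mxCo hn 0) (.cyl (mxCo hn 1) (.cyl (mxCo hn 2) H))))) := by
      refine ⟨⟨(mxEv_R hn M he hnm q hq v _ _).2 hg, mxEv_X hn M he w _ rfl⟩, ?_⟩
      simp [mxSEv, hH1']
    rw [h] at this
    exact this

end MadduxStd
section MadduxFinal
open Turing Turing.PartrecToTM2

theorem mx_trNat (m : ℕ) (hm : m ≠ 0) :
    trNat m = (if m % 2 = 0 then Γ'.bit0 else Γ'.bit1) :: trNat (m / 2) := by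
  have h1 : ∀ x : Num, trNum x.bit1 = Γ'.bit1 :: trNum x := by
    intro x; cases x <;> rfl
  have h0 : ∀ x : Num, x ≠ 0 → trNum x.bit0 = Γ'.bit0 :: trNum x := by
    intro x hx; cases x
    · exact absurd rfl hx
    · rfl
  rcases Nat.even_or_odd' m with ⟨t, rfl | rfl⟩
  · have ht : t ≠ 0 := by omega
    have h2 : ((2 * t : ℕ) : Num) = (t : Num).bit0 := by
      rw [← Num.bit0_of_bit0]; push_cast; ring
    have h3 : (t : Num) ≠ 0 := by exact_mod_cast ht
    have h4 : 2 * t / 2 = t := by omega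
    have h5 : 2 * t % 2 = 0 := by omega
    rw [trNat, h2, h0 _ h3, h4, if_pos h5, trNat]
  · have h2 : ((2 * t + 1 : ℕ) : Num) = (t : Num).bit1 := by
      rw [← Num.bit1_of_bit1]; push_cast; ring
    have h4 : (2 * t + 1) / 2 = t := by omega
    have h5 : ¬ ((2 * t + 1) % 2 = 0) := by omega
    rw [trNat, h2, h1, h4, if_neg h5, trNat]

def mxW (k : ℕ) : List (K' × Γ') := (trList [k]).map (fun s => (K'.main, s))

theorem mx_stk_map (L : List Γ') :
    mxStk (L.map (fun s => (K'.main, s))) = K'.elim L [] [] [] := by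
  induction L with
  | nil => funext k; cases k <;> rfl
  | cons a L ih =>
    simp only [List.map_cons, mxStk, ih]
    funext k; cases k <;> simp [Function.update]

theorem mxW_zero : mxW 0 = [(K'.main, Γ'.cons)] := by simp [mxW]

theorem mxW_succ (m : ℕ) (hm : m ≠ 0) :
    mxW m = (K'.main, if m % 2 = 0 then Γ'.bit0 else Γ'.bit1) :: mxW (m / 2) := by
  simp only [mxW, trList]
  rw [mx_trNat m hm]; simp

instance mxK_finite : Finite K' := by
  refine Finite.of_surjective (α := Fin 4)
    (fun i => if i = 0 then K'.main else if i = 1 then K'.rev else if i = 2 then K'.aux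
      else K'.stack) ?_
  intro k
  cases k
  · exact ⟨0, by simp⟩
  · exact ⟨1, by simp⟩
  · exact ⟨2, by simp⟩
  · exact ⟨3, by simp⟩

theorem mx_prim3 (f : ℕ → ℕ) (hf : ∀ l, f l = f (l % 3)) : Primrec f := by
  have hm : Primrec (fun l : ℕ => l % 3) := Primrec.nat_mod.comp .id (.const 3)
  refine (Primrec.ite (Primrec.eq.comp hm (.const 0)) (.const (f 0))
    (Primrec.ite (Primrec.eq.comp hm (.const 1)) (.const (f 1)) (.const (f 2)))).of_eq ?_
  intro l
  have : l % 3 < 3 := Nat.mod_lt _ (by norm_num)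
  rw [hf l]
  generalize l % 3 = m at *
  interval_cases m <;> simp

theorem mx_prim23 (f : ℕ → ℕ → ℕ) (hf : ∀ m l, f m l = f (m % 2) (l % 3)) : Primrec₂ f := by
  have hm : Primrec (fun x : ℕ × ℕ => x.1 % 2) := Primrec.nat_mod.comp .fst (.const 2)
  have h (b : ℕ) (hb : b < 2) : Primrec (f b) := mx_prim3 _ fun l => by
    rw [hf]; nth_rewrite 2 [hf]; simp
  refine (Primrec.ite (Primrec.eq.comp hm (.const 0)) ((h 0 (by simp)).comp .snd)
    ((h 1 (by simp)).comp .snd)).of_eq ?_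
  rintro ⟨m, l⟩
  have : m % 2 < 2 := Nat.mod_lt _ (by norm_num)
  dsimp only
  rw [hf m l]
  generalize m % 2 = m at *
  interval_cases m
  · simp; rw [hf]
  · simp; rw [hf]

theorem mx_pair : Primrec₂ Nat.pair := Primrec₂.natPair

theorem mx_primF (F : ℕ → ℕ × ℕ) (f : ℕ → ℕ → ℕ) (hf : ∀ m l, f m l = f (m % 2) (l % 3))
    (hF : ∀ m, m ≠ 0 → F m = (Nat.pair 6 (Nat.pair ((F (m/2)).2 % 3)
      (Nat.pair 4 (Nat.pair (F (m/2)).1 (f m (F (m/2)).2)))), (F (m/2)).2 + 1)) : Primrec F := by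
  have hm : Primrec (fun l : ℕ => l % 3) := Primrec.nat_mod.comp .id (.const 3)
  have hst : Primrec (fun y : ℕ × (ℕ × ℕ) => (Nat.pair 6 (Nat.pair (y.2.2 % 3)
      (Nat.pair 4 (Nat.pair y.2.1 (f y.1 y.2.2)))), y.2.2 + 1)) := by
    refine Primrec.pair ?_ (Primrec.succ.comp (Primrec.snd.comp .snd))
    refine mx_pair.comp (.const 6) (mx_pair.comp (hm.comp (Primrec.snd.comp .snd))
      (mx_pair.comp (.const 4) (mx_pair.comp (Primrec.fst.comp .snd)
        ((mx_prim23 f hf).comp .fst (Primrec.snd.comp .snd)))))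
  have hlen : Primrec (fun x : Unit × List (ℕ × ℕ) => x.2.length) := Primrec.list_length.comp .snd
  have h := Primrec.nat_strong_rec (fun _ : Unit => F)
    (g := fun _ L => if L.length = 0 then some (F 0) else
      (L[L.length / 2]?).map (fun x => (Nat.pair 6 (Nat.pair (x.2 % 3)
      (Nat.pair 4 (Nat.pair x.1 (f L.length x.2)))), x.2 + 1)))
    (by
      refine Primrec.ite (Primrec.eq.comp hlen (.const 0)) (.const _) ?_
      refine Primrec.option_map (Primrec.list_getElem?.comp .snd
        (Primrec.nat_div.comp hlen (.const 2))) ?_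
      exact hst.comp (Primrec.pair (hlen.comp .fst) .snd))
    (by
      intro _ m
      by_cases h0 : m = 0
      · subst h0; simp
      · have : m / 2 < m := by omega
        simp [h0, this, hF m h0])
  exact h.comp (.const ()) .id

theorem mx_source : ∃ c : ToPartrec.Code,
    ¬ ComputablePred fun k : ℕ => (c.eval [k]).Dom := by
  have hp : Partrec (fun v : List.Vector ℕ 1 =>
      Nat.Partrec.Code.eval (Denumerable.ofNat Nat.Partrec.Code v.head) 0) := 
    Nat.Partrec.Code.eval_part.comp ((Computable.ofNat _).comp
      (Primrec.vector_head.to_comp)) (.const 0)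
  obtain ⟨c, hc⟩ := ToPartrec.Code.exists_code (Nat.Partrec'.of_part hp)
  refine ⟨c, fun h => ComputablePred.halting_problem 0 ?_⟩
  refine ComputablePred.computable_of_manyOneReducible ⟨Encodable.encode, Computable.encode, ?_⟩ h
  intro d
  have := hc ⟨[Encodable.encode d], rfl⟩
  simp only at this
  rw [this]
  simp [List.Vector.head]

theorem mx_dom (c : ToPartrec.Code) (k : ℕ) :
    MxGood tr (tr (trNormal c Cont'.halt)) none (mxStk (mxW k)) ↔ (c.eval [k]).Dom := by
  have h := tr_eval c [k]
  have h1 : StateTransition.eval (TM2.step tr) (init c [k]) =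
      StateTransition.eval (TM2.step tr)
        (TM2.stepAux (tr (trNormal c Cont'.halt)) none (K'.elim (trList [k]) [] [] [])) :=
    StateTransition.reaches_eval (Relation.ReflTransGen.single rfl)
  unfold MxGood
  rw [mxW, mx_stk_map, ← h1, h]
  simp

def mxT (c : ToPartrec.Code) : Set (TM2.Stmt (fun _ : K' => Γ') Λ' (Option Γ')) :=
  {q | some q ∈ TM2.stmts tr (codeSupp c Cont'.halt)}

theorem mxT_finite (c : ToPartrec.Code) : (mxT c).Finite :=
  Set.Finite.preimage (Option.some_injective _).injOn (Finset.finite_toSet _)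

theorem mxT_mem (c : ToPartrec.Code) (l) (hl : l ∈ codeSupp c Cont'.halt) : tr l ∈ mxT c := by
  simp only [mxT, TM2.stmts, Set.mem_ofPred_eq, Finset.mem_insertNone, Finset.mem_biUnion,
    Option.mem_def, Option.some.injEq, forall_eq']
  exact ⟨l, hl, TM2.stmts₁_self⟩

theorem mxT_closed (c : ToPartrec.Code) : MxClosed tr (mxT c) where
  push k f q h := TM2.stmts_trans (by simp [TM2.stmts₁, TM2.stmts₁_self]) h
  pop k f q h := TM2.stmts_trans (by simp [TM2.stmts₁, TM2.stmts₁_self]) h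
  peek k f q h := TM2.stmts_trans (by simp [TM2.stmts₁, TM2.stmts₁_self]) h
  load f q h := TM2.stmts_trans (by simp [TM2.stmts₁, TM2.stmts₁_self]) h
  branch f q q' h := ⟨TM2.stmts_trans (by simp [TM2.stmts₁, TM2.stmts₁_self]) h,
    TM2.stmts_trans (by simp [TM2.stmts₁, TM2.stmts₁_self]) h⟩
  goto f h v := by
    have := @TM2.stmts_supportsStmt _ _ _ _ ⟨trNormal c Cont'.halt⟩ _ _ _ (tr_supports c Cont'.halt) h
    exact mxT_mem c _ (this v)

theorem mx_reduction (n : ℕ) (hn : 3 ≤ n) : ∃ (c : ToPartrec.Code) (t : ℕ → DfTerm n),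
    (¬ ComputablePred fun k : ℕ => (c.eval [k]).Dom) ∧
    Computable (fun k => Nat.pair (t k).code (DfTerm.bot : DfTerm n).code) ∧
    (∀ k, (c.eval [k]).Dom → DfEqValid n (t k) .bot) ∧
    (∀ k, ¬ (c.eval [k]).Dom → ∃ (A : CAlg (n : ℕ∞)) (v : ℕ → A.carrier),
      (t k).eval A.mxDf v ≠ DfTerm.eval A.mxDf v .bot) := by
  obtain ⟨c, hc⟩ := mx_source
  obtain ⟨e, he⟩ := exists_injective_nat (MxSym K' Γ' (Option Γ'))
  obtain ⟨nm, hnm⟩ := Set.countable_iff_exists_injOn.1 (mxT_finite c).countable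
  obtain ⟨H, hH⟩ := mx_exists_term hn tr he hnm (mxT_finite c) (mxT_closed c)
  have hq := mxT_mem c _ (tr_supports c Cont'.halt).1
  have hH' := fun k => hH _ hq none (mxW k)
  change ∀ k, (MxGood tr (tr (trNormal c Cont'.halt)) none _ → _) ∧ (¬ MxGood tr (tr (trNormal c Cont'.halt)) none _ → _) at hH'
  refine ⟨c, _, hc, ?_, fun k hk => (hH' k).1 ((mx_dom c k).2 hk),
    fun k hk => ⟨_, _, (hH' k).2 (fun h => hk ((mx_dom c k).1 h))⟩⟩
  have hF := mx_primF (fun k => ((mxTX hn e (mxW k)).code, (mxW k).length))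
    (fun m l => (mxTA hn e K'.main (if m % 2 = 0 then Γ'.bit0 else Γ'.bit1) l).code)
    (by intro m l; simp [mxTA, mxCo_mod2])
    (by
      intro m hm
      dsimp only
      rw [mxW_succ m hm]
      simp [mxTX, DfTerm.code, mxCo])
  have hr := mx_prim3 (fun l => (mxTR hn e nm (tr (trNormal c Cont'.halt)) none l).code)
    (by intro l; simp [mxTR, mxUn, mxCo_mod1, mxCo_mod2])
  refine Primrec.to_comp ?_
  simp only [DfTerm.code]
  refine mx_pair.comp (mx_pair.comp (.const 4) (mx_pair.comp (mx_pair.comp (.const 4)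
    (mx_pair.comp (hr.comp (Primrec.snd.comp hF)) (Primrec.fst.comp hF))) (.const _))) (.const _)

end MadduxFinal

/-- **Maddux.** For each finite `n ≥ 3`, the equational theory of the
variety `Df_n` of diagonal-free cylindric algebras of dimension `n` and the equational
theory of the variety `CA_n` of cylindric algebras of dimension `n` are undecidable. -/
theorem maddux_undecidability (n : ℕ) (hn : 3 ≤ n) :
    ¬ ComputablePred (fun m : ℕ =>
        ∃ s t : DfTerm n, Nat.pair s.code t.code = m ∧ DfEqValid n s t) ∧
    ¬ ComputablePred (fun m : ℕ =>
        ∃ s t : CTerm n, Nat.pair s.code t.code = m ∧ CAEqValid n s t) := by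
  obtain ⟨c, t, h1, h2, h3, h4⟩ := mx_reduction n hn
  constructor
  · intro h
    refine h1 (ComputablePred.computable_of_manyOneReducible ⟨_, h2, ?_⟩ h)
    intro k
    constructor
    · exact fun hk => ⟨_, _, rfl, h3 k hk⟩
    · rintro ⟨s, s', hs, hv⟩
      rw [Nat.pair_eq_pair] at hs
      obtain ⟨hs1, hs2⟩ := hs
      have e1 := DfTerm.mxCode_inj hs1
      have e2 := DfTerm.mxCode_inj hs2
      subst e1 e2
      by_contra hk
      obtain ⟨A, v, hA⟩ := h4 k hk
      exact hA (hv _ _)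
  · intro h
    refine h1 (ComputablePred.computable_of_manyOneReducible ⟨_, h2, ?_⟩ h)
    intro k
    constructor
    · intro hk
      refine ⟨(t k).mxEmb, DfTerm.bot.mxEmb, ?_, ?_⟩
      · rw [DfTerm.mxEmb_code, DfTerm.mxEmb_code]
      · intro A v
        rw [DfTerm.mxEmb_eval, DfTerm.mxEmb_eval]
        exact h3 k hk A.mxDf v
    · rintro ⟨s, s', hs, hv⟩
      rw [Nat.pair_eq_pair, ← DfTerm.mxEmb_code, ← DfTerm.mxEmb_code] at hs
      obtain ⟨hs1, hs2⟩ := hs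
      have e1 := CTerm.mxCode_inj hs1
      have e2 := CTerm.mxCode_inj hs2
      subst e1 e2
      by_contra hk
      obtain ⟨A, v, hA⟩ := h4 k hk
      have := hv A v
      rw [DfTerm.mxEmb_eval, DfTerm.mxEmb_eval] at this
      exact hA this
end
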